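/- (Kadeishvili) Let K be a field of characteristic 0 and let A be a differential graded algebra over K. Then there exists an A∞-algebra structure {mₙ} on the cohomology algebra H(A) with m₁ = 0 and m₂ equal to the product induced from A, together with a quasi-isomorphism of A∞-algebras H(A) → A; moreover this A∞-structure is unique up to isomorphism of A∞-algebras. -/

import Mathlib

/-! # Background definitions: graded vector spaces, `A∞`-algebras, dg-algebras,
Massey products, formality (following the conventions of the paper). -/

open scoped DirectSum

/-- A `ℤ`-graded vector space over `K`: a vector space together with a family of
subspaces indexed by `ℤ` into which it decomposes as a direct sum. -/
structure GVS (K : Type) [Field K] where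
  carrier : Type
  [acg : AddCommGroup carrier]
  [mod : Module K carrier]
  grading : ℤ → Submodule K carrier
  decomp : DirectSum.Decomposition grading

attribute [instance] GVS.acg GVS.mod

/-- A family of candidate `A∞`-operations on a graded vector space `V`:
`K`-multilinear maps `op n : V^{⊗ n} → V` of degree `2 - n`. -/
structure AInftyStr (K : Type) [Field K] (V : GVS K) where
  op : (n : ℕ) → MultilinearMap K (fun _ : Fin n => V.carrier) V.carrier
  op_degree : ∀ (n : ℕ) (e : Fin n → ℤ) (a : Fin n → V.carrier),
    (∀ i, a i ∈ V.grading (e i)) →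
    op n a ∈ V.grading ((∑ i, e i) + (2 - (n : ℤ)))

namespace AInftyStr

variable {K : Type} [Field K] {V : GVS K}

/-- The unary operation `m₁`, the candidate differential. -/
def d (m : AInftyStr K V) (x : V.carrier) : V.carrier :=
  m.op 1 (fun _ => x)

/-- The `n`-th Stasheff identity
`∑_{r+s+t=n} (-1)^{r+st} m_{r+1+t} (Id^{⊗r} ⊗ m_s ⊗ Id^{⊗t}) = 0`,
written out elementwise on homogeneous elements (the Koszul sign
`(-1)^{(2-s)(|a₁|+⋯+|a_r|)} = (-1)^{s(|a₁|+⋯+|a_r|)}` appears when evaluating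
`Id^{⊗r} ⊗ m_s ⊗ Id^{⊗t}` on elements). -/
def Stasheff (m : AInftyStr K V) (n : ℕ) : Prop :=
  ∀ (e : ℕ → ℤ) (a : ℕ → V.carrier), (∀ i, a i ∈ V.grading (e i)) →
    ∑ r ∈ Finset.range n, ∑ s ∈ Finset.Icc 1 (n - r),
      ((-1 : K) ^ ((r : ℤ) + (s : ℤ) * ((n : ℤ) - (r : ℤ) - (s : ℤ))
          + (s : ℤ) * ∑ i ∈ Finset.range r, e i)) •
        m.op (r + 1 + (n - r - s)) (fun j : Fin (r + 1 + (n - r - s)) =>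
          if (j : ℕ) < r then a j
          else if (j : ℕ) = r then m.op s (fun i : Fin s => a (r + (i : ℕ)))
          else a ((j : ℕ) + s - 1)) = 0

end AInftyStr

/-- An `A∞`-algebra over `K`: a graded vector space with multilinear operations
of degree `2 - n` satisfying all Stasheff identities. -/
structure AInftyAlg (K : Type) [Field K] where
  V : GVS K
  str : AInftyStr K V
  stasheff : ∀ n, 1 ≤ n → str.Stasheff n

/-- The data of an `A∞`-morphism between graded vector spaces equipped with
operations: multilinear maps `f n : V^{⊗n} → W` of degree `1 - n`. -/
structure AInftyHomData (K : Type) [Field K] (V W : GVS K) where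
  f : (n : ℕ) → MultilinearMap K (fun _ : Fin n => V.carrier) W.carrier
  f_degree : ∀ (n : ℕ) (e : Fin n → ℤ) (a : Fin n → V.carrier),
    (∀ i, a i ∈ V.grading (e i)) →
    f n a ∈ W.grading ((∑ i, e i) + (1 - (n : ℤ)))

namespace AInftyHomData

variable {K : Type} [Field K] {V W : GVS K}

/-- The linear component `f₁` of an `A∞`-morphism. -/
def f1 (φ : AInftyHomData K V W) (x : V.carrier) : W.carrier :=
  φ.f 1 (fun _ => x)

/-- The `n`-th `A∞`-morphism equation
`∑_{r+s+t=n} (-1)^{r+st} f_{r+1+t}(id^{⊗r} ⊗ m_s ⊗ id^{⊗t})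
  = ∑_k ∑_{i₁+⋯+i_k=n} (-1)^{u_k} m_k (f_{i₁} ⊗ ⋯ ⊗ f_{i_k})`,
with `u_k = ∑_{t=1}^{k-1} t (i_{k-t} - 1)`, written out elementwise on
homogeneous elements (including the Koszul signs coming from evaluating tensor
products of graded maps on elements). -/
def Eqn (φ : AInftyHomData K V W) (mV : AInftyStr K V) (mW : AInftyStr K W)
    (n : ℕ) : Prop :=
  ∀ (e : ℕ → ℤ) (a : ℕ → V.carrier), (∀ i, a i ∈ V.grading (e i)) →
    (∑ r ∈ Finset.range n, ∑ s ∈ Finset.Icc 1 (n - r),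
      ((-1 : K) ^ ((r : ℤ) + (s : ℤ) * ((n : ℤ) - (r : ℤ) - (s : ℤ))
          + (s : ℤ) * ∑ i ∈ Finset.range r, e i)) •
        φ.f (r + 1 + (n - r - s)) (fun j : Fin (r + 1 + (n - r - s)) =>
          if (j : ℕ) < r then a j
          else if (j : ℕ) = r then mV.op s (fun i : Fin s => a (r + (i : ℕ)))
          else a ((j : ℕ) + s - 1)))
    =
    ∑ c : Composition n,
      ((-1 : K) ^ ((∑ j : Fin c.length,
            ((c.length : ℤ) - 1 - (j : ℤ)) * ((c.blocksFun j : ℤ) - 1))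
          + ∑ j : Fin c.length,
            (1 - (c.blocksFun j : ℤ)) * ∑ i ∈ Finset.range (c.sizeUpTo (j : ℕ)), e i)) •
        mW.op c.length (fun j : Fin c.length =>
          φ.f (c.blocksFun j) (fun i : Fin (c.blocksFun j) =>
            a (c.sizeUpTo (j : ℕ) + (i : ℕ))))

/-- `φ` is a quasi-isomorphism: its linear part `f₁` induces an isomorphism on
cohomology (injectivity and surjectivity of the induced map, spelled out). -/
def IsQuasiIso (φ : AInftyHomData K V W) (mV : AInftyStr K V) (mW : AInftyStr K W) : Prop :=
  (∀ x, mV.d x = 0 → (∃ c, φ.f1 x = mW.d c) → ∃ c, x = mV.d c) ∧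
  (∀ y, mW.d y = 0 → ∃ x, mV.d x = 0 ∧ ∃ c, y - φ.f1 x = mW.d c)

end AInftyHomData

/-- `φ` is an `A∞`-morphism from `(V, mV)` to `(W, mW)`: all morphism equations hold. -/
def IsAInftyMorphism {K : Type} [Field K] {V W : GVS K} (φ : AInftyHomData K V W)
    (mV : AInftyStr K V) (mW : AInftyStr K W) : Prop :=
  ∀ n, 1 ≤ n → φ.Eqn mV mW n

/-- A dg-algebra: an `A∞`-algebra whose operations of arity `≥ 3` vanish. -/
structure DGAlg (K : Type) [Field K] where
  V : GVS K
  str : AInftyStr K V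
  stasheff : ∀ n, 1 ≤ n → str.Stasheff n
  higher : ∀ n, 3 ≤ n → str.op n = 0

namespace DGAlg

variable {K : Type} [Field K]

/-- The differential of a dg-algebra. -/
def d (A : DGAlg K) (x : A.V.carrier) : A.V.carrier := A.str.d x

/-- The product of a dg-algebra. -/
def mul (A : DGAlg K) (x y : A.V.carrier) : A.V.carrier := A.str.op 2 ![x, y]

/-- A dg-algebra is formal if it is `A∞`-quasi-isomorphic to a dg-algebra with
trivial differential. -/
def IsFormal (A : DGAlg K) : Prop :=
  ∃ B : DGAlg K, (∀ x, B.d x = 0) ∧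
    ∃ φ : AInftyHomData K B.V A.V, IsAInftyMorphism φ B.str A.str ∧
      φ.IsQuasiIso B.str A.str

end DGAlg

/-! ## Presentations of the cohomology algebra of a dg-algebra -/

/-- A presentation of the cohomology algebra `H(A)` of a dg-algebra `A`:
a dg-algebra `H` with trivial differential together with a "cohomology class"
assignment `cls` on cocycles of `A`, which is linear, surjective, kills exactly
the coboundaries, respects the gradings, and turns the product of cocycles into
the product of `H` (so the product of `H` is the product induced from `A`). -/
structure CohomPres (K : Type) [Field K] (A : DGAlg K) where
  H : DGAlg K
  trivial_d : ∀ x, H.d x = 0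
  cls : A.V.carrier → H.V.carrier
  cls_add : ∀ x y, A.d x = 0 → A.d y = 0 → cls (x + y) = cls x + cls y
  cls_smul : ∀ (k : K) x, A.d x = 0 → cls (k • x) = k • cls x
  cls_surj : ∀ h, ∃ x, A.d x = 0 ∧ cls x = h
  cls_zero_iff : ∀ x, A.d x = 0 → (cls x = 0 ↔ ∃ c, x = A.d c)
  cls_grading : ∀ (i : ℤ) x, A.d x = 0 → x ∈ A.V.grading i → cls x ∈ H.V.grading i
  cls_grading_surj : ∀ (i : ℤ) h, h ∈ H.V.grading i →
    ∃ x, A.d x = 0 ∧ x ∈ A.V.grading i ∧ cls x = h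
  cls_mul : ∀ x y, A.d x = 0 → A.d y = 0 →
    cls (A.mul x y) = H.mul (cls x) (cls y)

/-- A morphism of dg-algebras: a linear map commuting with the differentials,
multiplicative, and preserving the grading. -/
structure DGHom {K : Type} [Field K] (A B : DGAlg K) where
  g : A.V.carrier →ₗ[K] B.V.carrier
  comm_d : ∀ x, g (A.d x) = B.d (g x)
  map_mul : ∀ x y, g (A.mul x y) = B.mul (g x) (g y)
  map_grading : ∀ (i : ℤ) x, x ∈ A.V.grading i → g x ∈ B.V.grading i

/-- A morphism of dg-algebras is a quasi-isomorphism if it induces an isomorphism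
on cohomology (injectivity and surjectivity of the induced map, spelled out). -/
def DGHom.IsQuasiIso {K : Type} [Field K] {A B : DGAlg K} (φ : DGHom A B) : Prop :=
  (∀ x, A.d x = 0 → (∃ c, φ.g x = B.d c) → ∃ c, x = A.d c) ∧
  (∀ y, B.d y = 0 → ∃ x, A.d x = 0 ∧ ∃ c, y - φ.g x = B.d c)

/-! ## Multilinear functions on words -/

namespace BarWords

variable {K : Type} [Field K]

/-- The sum of `H x y` over all deconcatenations `w = x ++ y`. -/
def split {α M : Type} [AddCommGroup M] : (List α → List α → M) → List α → M
  | H, [] => H [] []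
  | H, a :: w => H [] (a :: w) + split (fun x y => H (a :: x) y) w

section split

variable {α M N : Type} [AddCommGroup M] [Module K M] [AddCommGroup N] [Module K N]

theorem split_congr {H H' : List α → List α → M} {w : List α}
    (h : ∀ x y, x ++ y = w → H x y = H' x y) : split H w = split H' w := by
  induction w generalizing H H' with
  | nil => exact h [] [] rfl
  | cons a w ih =>
    simp only [split]
    rw [h [] (a :: w) rfl, ih fun x y hxy => h (a :: x) y (by rw [← hxy]; rfl)]

theorem split_add (H H' : List α → List α → M) (w : List α) :
    split (fun x y => H x y + H' x y) w = split H w + split H' w := by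
  induction w generalizing H H' with
  | nil => rfl
  | cons a w ih => simp only [split, ih]; abel

theorem split_zero (w : List α) : split (fun _ _ => (0 : M)) w = 0 := by
  induction w with
  | nil => rfl
  | cons a w ih => simp only [split, ih, add_zero]

theorem map_split (f : M →ₗ[K] N) (H : List α → List α → M) (w : List α) :
    f (split H w) = split (fun x y => f (H x y)) w := by
  induction w generalizing H with
  | nil => rfl
  | cons a w ih => simp only [split, map_add, ih]

theorem split_neg (H : List α → List α → M) (w : List α) :
    split (fun x y => -H x y) w = -split H w := by
  induction w generalizing H with
  | nil => rfl
  | cons a w ih => simp only [split, ih]; abel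

theorem split_sub (H H' : List α → List α → M) (w : List α) :
    split (fun x y => H x y - H' x y) w = split H w - split H' w := by
  simp only [sub_eq_add_neg, split_add, split_neg]

theorem split_eq_zero {H : List α → List α → M} {w : List α}
    (h : ∀ x y, x ++ y = w → H x y = 0) : split H w = 0 := by
  rw [split_congr h, split_zero]

/-- Coassociativity of deconcatenation. -/
theorem split_split (H : List α → List α → List α → M) (w : List α) :
    split (fun x y => split (fun x₁ x₂ => H x₁ x₂ y) x) w =
      split (fun x y => split (fun y₁ y₂ => H x y₁ y₂) y) w := by
  induction w generalizing H with
  | nil => rfl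
  | cons a w ih =>
    simp only [split, split_add, ih fun x₁ x₂ y => H (a :: x₁) x₂ y]
    abel

theorem split_eq_last {H : List α → List α → M} {w : List α}
    (h : ∀ x y, x ++ y = w → y ≠ [] → H x y = 0) : split H w = H w [] := by
  induction w generalizing H with
  | nil => rfl
  | cons a w ih =>
    simp only [split]
    rw [h [] (a :: w) rfl (by simp), zero_add,
      ih fun x y hxy hy => h (a :: x) y (by rw [← hxy]; rfl) hy]

theorem split_map {β : Type} (f : β → α) (H : List α → List α → M) (w : List β) :
    split H (w.map f) = split (fun x y => H (x.map f) (y.map f)) w := by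
  induction w generalizing H with
  | nil => rfl
  | cons a w ih => simp only [split, List.map_cons, ih, List.map_nil]

end split

/-- Precomposition of a function on words with the coderivation of the tensor coalgebra whose
corestriction is `b`; the involution `σ` carries the Koszul signs. -/
def coder {V M : Type} [AddCommGroup M] (σ : V → V) (b : List V → V) :
    (List V → M) → List V → M
  | _, [] => 0
  | F, a :: w => coder σ b (fun x => F (σ a :: x)) w + split (fun x y => F (b (a :: x) :: y)) w

/-- Auxiliary recursion for `com`: `c` is the block currently being read. -/
def comAux {V W M : Type} [AddCommGroup M] (ψ : List V → W) :
    (List W → M) → List V → List V → M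
  | F, c, [] => F [ψ c]
  | F, c, a :: w => comAux ψ F (c ++ [a]) w + comAux ψ (fun x => F (ψ c :: x)) [a] w

/-- Precomposition of a function on words with the coalgebra morphism of tensor coalgebras whose
corestriction is `ψ`. -/
def com {V W M : Type} [AddCommGroup M] (ψ : List V → W) (F : List W → M) : List V → M
  | [] => F []
  | a :: w => comAux ψ F [a] w

/-- Multilinearity of a function on words. -/
def ML (K : Type) [Field K] {V M : Type} [AddCommGroup V] [Module K V] [AddCommGroup M]
    [Module K M] (F : List V → M) : Prop :=
  (∀ u v x y, F (u ++ (x + y) :: v) = F (u ++ x :: v) + F (u ++ y :: v)) ∧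
    ∀ u v (c : K) x, F (u ++ (c • x) :: v) = c • F (u ++ x :: v)

section coder

variable {V M N : Type} [AddCommGroup M] [Module K M] [AddCommGroup N] [Module K N]
  (σ : V → V) (b : List V → V)

theorem coder_add (F G : List V → M) (w : List V) :
    coder σ b (fun x => F x + G x) w = coder σ b F w + coder σ b G w := by
  induction w generalizing F G with
  | nil => simp [coder]
  | cons a w ih => simp only [coder, ih, split_add]; abel

theorem coder_zero (w : List V) : coder σ b (fun _ => (0 : M)) w = 0 := by
  induction w with
  | nil => rfl
  | cons a w ih => simp only [coder, ih, split_zero, add_zero]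

theorem map_coder (f : M →ₗ[K] N) (F : List V → M) (w : List V) :
    f (coder σ b F w) = coder σ b (fun x => f (F x)) w := by
  induction w generalizing F with
  | nil => simp [coder]
  | cons a w ih => simp only [coder, map_add, ih, map_split]

theorem coder_neg (F : List V → M) (w : List V) :
    coder σ b (fun x => -F x) w = -coder σ b F w := by
  induction w generalizing F with
  | nil => simp [coder]
  | cons a w ih => simp only [coder, ih, split_neg]; abel

theorem coder_split (H : List V → List V → M) (w : List V) :
    coder σ b (split H) w =
      split (fun x y => coder σ b (fun x' => H x' y) x + coder σ b (H (x.map σ)) y) w := by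
  induction w generalizing H with
  | nil => simp [coder, split]
  | cons a w ih =>
    have e : coder σ b (fun x => split H (σ a :: x)) w =
        coder σ b (fun x => H [] (σ a :: x)) w +
          coder σ b (split fun x y => H (σ a :: x) y) w := by
      rw [← coder_add]; rfl
    rw [coder, e, ih]
    simp only [coder, split, List.map_cons, List.map_nil, split_add,
      split_split fun x₁ x₂ y => H (b (a :: x₁) :: x₂) y]
    abel

end coder

section com

variable {V W M N : Type} [AddCommGroup M] [Module K M] [AddCommGroup N] [Module K N]
  (ψ : List V → W)

theorem comAux_eq (F : List W → M) (c w : List V) :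
    comAux ψ F c w = split (fun x y => com ψ (fun z => F (ψ (c ++ x) :: z)) y) w := by
  induction w generalizing c with
  | nil => simp [comAux, split, com]
  | cons a w ih =>
    simp only [comAux, split, ih (c ++ [a]), List.append_nil, com, List.append_assoc,
      List.singleton_append]
    abel

theorem com_cons (F : List W → M) (a : V) (w : List V) :
    com ψ F (a :: w) = split (fun x y => com ψ (fun z => F (ψ (a :: x) :: z)) y) w := by
  rw [com, comAux_eq]; rfl

theorem comAux_add (F G : List W → M) (c w : List V) :
    comAux ψ (fun x => F x + G x) c w = comAux ψ F c w + comAux ψ G c w := by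
  induction w generalizing F G c with
  | nil => rfl
  | cons a w ih => simp only [comAux, ih]; abel

theorem com_add (F G : List W → M) (w : List V) :
    com ψ (fun x => F x + G x) w = com ψ F w + com ψ G w := by
  cases w with
  | nil => rfl
  | cons a w => exact comAux_add ψ F G [a] w

theorem map_comAux (f : M →ₗ[K] N) (F : List W → M) (c w : List V) :
    f (comAux ψ F c w) = comAux ψ (fun x => f (F x)) c w := by
  induction w generalizing F c with
  | nil => rfl
  | cons a w ih => simp only [comAux, map_add, ih]

theorem map_com (f : M →ₗ[K] N) (F : List W → M) (w : List V) :
    f (com ψ F w) = com ψ (fun x => f (F x)) w := by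
  cases w with
  | nil => rfl
  | cons a w => exact map_comAux ψ f F [a] w

theorem com_zero (w : List V) : com ψ (fun _ => (0 : M)) w = 0 := by
  have h := com_add ψ (fun _ => (0 : M)) (fun _ => 0) w
  simpa using h

/-- Compatibility of a coalgebra morphism with deconcatenation. -/
theorem com_split (H : List W → List W → M) (w : List V) :
    com ψ (split H) w = split (fun x y => com ψ (fun x' => com ψ (H x') y) x) w := by
  induction hn : w.length using Nat.strong_induction_on generalizing H w with
  | _ n ih =>
  cases w with
  | nil => rfl
  | cons a w =>
    rw [com_cons]
    have e : ∀ x y, x ++ y = w → com ψ (fun z => split H (ψ (a :: x) :: z)) y =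
        com ψ (fun z => H [] (ψ (a :: x) :: z)) y +
          split (fun y₁ y₂ => com ψ (fun x' => com ψ (H (ψ (a :: x) :: x')) y₂) y₁) y := by
      intro x y hxy
      have hy : y.length < n := by
        rw [← hn, ← hxy]; simp
      rw [← ih _ hy (fun x' y' => H (ψ (a :: x) :: x') y') y rfl, ← com_add]
      rfl
    rw [split_congr e, split_add, ← split_split]
    simp only [split, com_cons]
    rfl

end com

section ML

variable {V W M N : Type} [AddCommGroup V] [Module K V] [AddCommGroup W] [Module K W]
  [AddCommGroup M] [Module K M] [AddCommGroup N] [Module K N]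

theorem ML.cons {F : List V → M} (h : ML K F) (a : V) : ML K fun x => F (a :: x) :=
  ⟨fun u v x y => h.1 (a :: u) v x y, fun u v c x => h.2 (a :: u) v c x⟩

/-- The linear dependence of a multilinear function on the first letter. -/
def ML.head {F : List V → M} (h : ML K F) (w : List V) : V →ₗ[K] M where
  toFun v := F (v :: w)
  map_add' := h.1 [] w
  map_smul' := h.2 [] w

@[simp] theorem ML.head_apply {F : List V → M} (h : ML K F) (w : List V) (v : V) :
    h.head w v = F (v :: w) := rfl

theorem ML.zero_cons {F : List V → M} (h : ML K F) (w : List V) : F (0 :: w) = 0 :=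
  (h.head w).map_zero

/-- If `b` vanishes on letters, the coderivation strictly shortens words. -/
theorem coder_congr (σ : V → V) {b : List V → V} (hb : ∀ v, b [v] = 0) {F G : List V → M}
    (hF : ML K F) (hG : ML K G) {w : List V} (h : ∀ x, x.length < w.length → F x = G x) :
    coder σ b F w = coder σ b G w := by
  induction w generalizing F G with
  | nil => rfl
  | cons a w ih =>
    simp only [coder]
    rw [ih (hF.cons _) (hG.cons _) fun x hx => h _ (by simpa using hx)]
    congr 1
    refine split_congr fun x y hxy => ?_
    cases x with
    | nil => rw [hb, hF.zero_cons, hG.zero_cons]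
    | cons c x => exact h _ (by rw [← hxy]; simp)

theorem ML.add {F G : List V → M} (hF : ML K F) (hG : ML K G) : ML K fun x => F x + G x :=
  ⟨fun u v x y => by simp only [hF.1, hG.1]; abel, fun u v c x => by simp only [hF.2, hG.2, smul_add]⟩

theorem ML.map {F : List V → M} (hF : ML K F) (f : M →ₗ[K] N) : ML K fun x => f (F x) :=
  ⟨fun u v x y => by simp only [hF.1, map_add], fun u v c x => by simp only [hF.2, map_smul]⟩

theorem ML.neg {F : List V → M} (hF : ML K F) : ML K fun x => -F x :=
  hF.map (-LinearMap.id)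

theorem ML.sub {F G : List V → M} (hF : ML K F) (hG : ML K G) : ML K fun x => F x - G x := by
  simpa only [sub_eq_add_neg] using hF.add hG.neg

theorem ML.mapList {F : List V → M} (hF : ML K F) (f : W →ₗ[K] V) :
    ML K fun x => F (x.map f) :=
  ⟨fun u v x y => by simp only [List.map_append, List.map_cons, map_add, hF.1],
    fun u v c x => by simp only [List.map_append, List.map_cons, map_smul, hF.2]⟩

theorem split_smul (c : K) {α : Type} (H : List α → List α → M) (w : List α) :
    split (fun x y => c • H x y) w = c • split H w :=
  (map_split (c • LinearMap.id : M →ₗ[K] M) H w).symm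

theorem coder_smul (c : K) {α : Type} (σ : α → α) (b : List α → α) (H : List α → M)
    (w : List α) : coder σ b (fun x => c • H x) w = c • coder σ b H w :=
  (map_coder σ b (c • LinearMap.id : M →ₗ[K] M) H w).symm

theorem comAux_smul (c : K) {α β : Type} (ψ : List α → β) (H : List β → M)
    (d w : List α) : comAux ψ (fun x => c • H x) d w = c • comAux ψ H d w :=
  (map_comAux ψ (c • LinearMap.id : M →ₗ[K] M) H d w).symm

theorem ML.split {H : List V → List V → M} (h₁ : ∀ y, ML K fun x => H x y)
    (h₂ : ∀ x, ML K (H x)) : ML K (split H) := by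
  constructor
  · intro u
    induction u generalizing H with
    | nil =>
      intro v x y
      have e : ∀ x' y', H ((x + y) :: x') y' = H (x :: x') y' + H (y :: x') y' :=
        fun x' y' => (h₁ y').1 [] x' x y
      have e' := (h₂ []).1 [] v x y
      simp only [List.nil_append] at e'
      simp only [List.nil_append, BarWords.split, e, split_add, e']
      abel
    | cons a u ih =>
      intro v x y
      have e' := (h₂ []).1 (a :: u) v x y
      simp only [List.cons_append] at e'
      simp only [List.cons_append, BarWords.split, e',
        ih (H := fun x y => H (a :: x) y) (fun y => (h₁ y).cons a) (fun x => h₂ _)]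
      abel
  · intro u
    induction u generalizing H with
    | nil =>
      intro v c x
      have e : ∀ x' y', H ((c • x) :: x') y' = c • H (x :: x') y' :=
        fun x' y' => (h₁ y').2 [] x' c x
      have e' := (h₂ []).2 [] v c x
      simp only [List.nil_append] at e'
      simp only [List.nil_append, BarWords.split, e, split_smul, e', smul_add]
    | cons a u ih =>
      intro v c x
      have e' := (h₂ []).2 (a :: u) v c x
      simp only [List.cons_append] at e'
      simp only [List.cons_append, BarWords.split, e', smul_add,
        ih (H := fun x y => H (a :: x) y) (fun y => (h₁ y).cons a) (fun x => h₂ _)]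

theorem ML.coder {F : List V → M} (hF : ML K F) {b : List V → V} (hb : ML K b) (σ : V →ₗ[K] V) :
    ML K (coder σ b F) := by
  have hs : ∀ a, ∀ {G : List V → M}, ML K G →
      ML K (BarWords.split fun x y => G (b (a :: x) :: y)) := fun a {G} hG =>
    ML.split (fun y => (hb.cons a).map (hG.head y)) (fun x => hG.cons _)
  constructor
  · intro u
    induction u generalizing F with
    | nil =>
      intro v x y
      simp only [List.nil_append, BarWords.coder, map_add]
      have e₁ : ∀ z, F ((σ x + σ y) :: z) = F (σ x :: z) + F (σ y :: z) :=
        fun z => hF.1 [] z _ _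
      have e₂ : ∀ p q, F (b ((x + y) :: p) :: q) = F (b (x :: p) :: q) + F (b (y :: p) :: q) := by
        intro p q
        have := hb.1 [] p x y
        simp only [List.nil_append] at this
        rw [this]; exact hF.1 [] q _ _
      simp only [e₁, e₂, coder_add, split_add]
      abel
    | cons a u ih =>
      intro v x y
      simp only [List.cons_append, BarWords.coder, ih (hF.cons _), (hs a hF).1]
      abel
  · intro u
    induction u generalizing F with
    | nil =>
      intro v c x
      simp only [List.nil_append, BarWords.coder, map_smul]
      have e₁ : ∀ z, F ((c • σ x) :: z) = c • F (σ x :: z) :=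
        fun z => hF.2 [] z _ _
      have e₂ : ∀ p q, F (b ((c • x) :: p) :: q) = c • F (b (x :: p) :: q) := by
        intro p q
        have := hb.2 [] p c x
        simp only [List.nil_append] at this
        rw [this]; exact hF.2 [] q _ _
      simp only [e₁, e₂, coder_smul, split_smul, smul_add]
    | cons a u ih =>
      intro v c x
      simp only [List.cons_append, BarWords.coder, ih (hF.cons _), (hs a hF).2, smul_add]

theorem ML.comAux_block {F : List W → M} (hF : ML K F) {ψ : List V → W} (hψ : ML K ψ)
    (w : List V) : ML K fun c => comAux ψ F c w := by
  have key : ∀ a u v (x : V), (u ++ x :: v) ++ [a] = u ++ x :: (v ++ [a]) := by simp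
  constructor
  · induction w generalizing F with
    | nil =>
      intro u v x y
      simp only [comAux, hψ.1]
      exact hF.1 [] [] _ _
    | cons a w ih =>
      intro u v x y
      have e : ∀ z, F ((ψ (u ++ x :: v) + ψ (u ++ y :: v)) :: z) =
        F (ψ (u ++ x :: v) :: z) + F (ψ (u ++ y :: v) :: z) := fun z => hF.1 [] z _ _
      simp only [comAux, hψ.1, key, ih hF, e, comAux_add]
      abel
  · induction w generalizing F with
    | nil =>
      intro u v x y
      simp only [comAux, hψ.2]
      exact hF.2 [] [] _ _
    | cons a w ih =>
      intro u v c x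
      have e : ∀ z, F ((c • ψ (u ++ x :: v)) :: z) =
        c • F (ψ (u ++ x :: v) :: z) := fun z => hF.2 [] z _ _
      simp only [comAux, hψ.2, key, ih hF, e, comAux_smul, smul_add]

theorem ML.comAux {F : List W → M} (hF : ML K F) {ψ : List V → W} (hψ : ML K ψ)
    (c : List V) : ML K (comAux ψ F c) := by
  constructor
  · intro u
    induction u generalizing F c with
    | nil =>
      intro v x y
      have h₁ := (ML.comAux_block hF hψ v).1 c [] x y
      have h₂ := (ML.comAux_block (hF.cons (ψ c)) hψ v).1 [] [] x y
      simp only [List.nil_append] at h₂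
      simp only [List.nil_append, BarWords.comAux, h₁, h₂]
      abel
    | cons a u ih =>
      intro v x y
      simp only [List.cons_append, BarWords.comAux, ih hF, ih (hF.cons _)]
      abel
  · intro u
    induction u generalizing F c with
    | nil =>
      intro v k x
      have h₁ := (ML.comAux_block hF hψ v).2 c [] k x
      have h₂ := (ML.comAux_block (hF.cons (ψ c)) hψ v).2 [] [] k x
      simp only [List.nil_append] at h₂
      simp only [List.nil_append, BarWords.comAux, h₁, h₂, smul_add]
    | cons a u ih =>
      intro v k x
      simp only [List.cons_append, BarWords.comAux, ih hF, ih (hF.cons _), smul_add]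

theorem ML.com {F : List W → M} (hF : ML K F) {ψ : List V → W} (hψ : ML K ψ) :
    ML K (com ψ F) := by
  constructor
  · rintro (_ | ⟨a, u⟩) v x y
    · exact (ML.comAux_block hF hψ v).1 [] [] x y
    · exact (ML.comAux hF hψ [a]).1 u v x y
  · rintro (_ | ⟨a, u⟩) v k x
    · exact (ML.comAux_block hF hψ v).2 [] [] k x
    · exact (ML.comAux hF hψ [a]).2 u v k x

end ML

section square

variable {V W M : Type} [AddCommGroup V] [Module K V] [AddCommGroup W] [Module K W]
  [AddCommGroup M] [Module K M]

/-- A coderivation whose corestriction squares to zero squares to zero. -/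
theorem coder_coder {σ : V →ₗ[K] V} (hσ : ∀ v, σ (σ v) = v) {b : List V → V}
    (hpar : ∀ w, b (w.map σ) = -σ (b w)) (hbb : ∀ w, coder σ b b w = 0)
    {F : List V → M} (hF : ML K F) (w : List V) : coder σ b (coder σ b F) w = 0 := by
  induction w generalizing F with
  | nil => rfl
  | cons a w ih =>
    have e₁ : coder σ b (fun x => coder σ b F (σ a :: x)) w =
        coder σ b (split fun x y => F (b (σ a :: x) :: y)) w := by
      have := ih (hF.cons a)
      simp only [coder, coder_add, hσ]
      rw [this, zero_add]
    have e₂ : ∀ x y, coder σ b (fun z => F (b (σ a :: x.map σ) :: z)) y =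
        -coder σ b (fun z => F (σ (b (a :: x)) :: z)) y := by
      intro x y
      have h : b (σ a :: x.map σ) = -σ (b (a :: x)) := hpar (a :: x)
      rw [h, ← coder_neg]
      congr 1
      funext z
      exact (hF.head z).map_neg _
    have e₃ : ∀ x y, coder σ b (fun z => F (b (σ a :: z) :: y)) x +
        split (fun x₁ x₂ => F (b (b (a :: x₁) :: x₂) :: y)) x = 0 := by
      intro x y
      have h := congrArg (hF.head y) (hbb (a :: x))
      rw [coder, map_add, map_coder, map_split, map_zero] at h
      exact h
    rw [coder, e₁, coder_split]
    simp only [coder, e₂, split_add, split_neg]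
    rw [← split_split fun x y₁ y₂ => F (b (b (a :: x) :: y₁) :: y₂)]
    have e₄ := split_eq_zero (w := w) fun x y _ => e₃ x y
    rw [split_add] at e₄
    rw [← e₄]
    abel

theorem coder_map {σ : V →ₗ[K] V} {b : List V → V}
    (hpar : ∀ w, b (w.map σ) = -σ (b w)) {F : List V → M} (hF : ML K F) (w : List V) :
    coder σ b (fun x => F (x.map σ)) w = -coder σ b F (w.map σ) := by
  induction w generalizing F with
  | nil => simp [coder]
  | cons a w ih =>
    have e : ∀ x y : List V, F (b (σ a :: x.map σ) :: y.map σ) =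
        -F (σ (b (a :: x)) :: y.map σ) := by
      intro x y
      have h : b (σ a :: x.map σ) = -σ (b (a :: x)) := hpar (a :: x)
      rw [h]
      exact (hF.head _).map_neg _
    simp only [List.map_cons, coder, ih (hF.cons _), split_map, e, split_neg]
    abel

/-- The linear dependence of `com ψ F` on an additional first letter of `F`. -/
def comHead {F : List W → M} (hF : ML K F) (ψ : List V → W) (y : List V) : W →ₗ[K] M where
  toFun u := com ψ (fun z => F (u :: z)) y
  map_add' u v := by
    rw [← com_add]
    congr 1
    funext z
    exact (hF.head z).map_add u v
  map_smul' c u := by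
    have := map_com ψ (c • LinearMap.id : M →ₗ[K] M) (fun z => F (u :: z)) y
    refine Eq.trans ?_ this.symm
    congr 1
    funext z
    exact (hF.head z).map_smul c u

theorem comHead_apply {V W M : Type} [AddCommGroup W] [Module K W] [AddCommGroup M] [Module K M]
    {F : List W → M} (hF : ML K F) (ψ : List V → W) (y : List V) (u : W) :
    comHead hF ψ y u = com ψ (fun z => F (u :: z)) y := rfl

/-- The failure of a coalgebra morphism to commute with coderivations, in the lowest arity in which
its corestriction does not vanish. -/
theorem coder_com {σ : V →ₗ[K] V} {σ' : W →ₗ[K] W} {b : List V → V} {b' : List W → W}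
    {ψ : List V → W} (hψ : ∀ w, ψ (w.map σ) = σ' (ψ w)) (hb' : b' [] = 0)
    {F : List W → M} (hF : ML K F) {w : List V}
    (hX : ∀ x, x.length < w.length → coder σ b ψ x - com ψ b' x = 0) :
    coder σ b (com ψ F) w - com ψ (coder σ' b' F) w = F [coder σ b ψ w - com ψ b' w] := by
  induction hn : w.length using Nat.strong_induction_on generalizing F w with
  | _ n ih =>
  cases w with
  | nil =>
    simp only [coder, com, hb', sub_zero]
    exact (hF.zero_cons []).symm
  | cons a w =>
    have e₀ : coder σ b (com ψ F) (a :: w) = split (fun x y =>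
        com ψ (fun z => F (coder σ b ψ (a :: x) :: z)) y +
          coder σ b (com ψ fun z => F (σ' (ψ (a :: x)) :: z)) y) w := by
      have h₁ : ∀ x y : List V, (fun z => F (ψ (σ a :: x.map σ) :: z)) =
          fun z => F (σ' (ψ (a :: x)) :: z) := by
        intro x y
        have : ψ (σ a :: x.map σ) = σ' (ψ (a :: x)) := hψ (a :: x)
        rw [this]
      have h₂ : coder σ b (fun x => com ψ F (σ a :: x)) w = coder σ b
          (split fun x y => com ψ (fun z => F (ψ (σ a :: x) :: z)) y) w := by
        congr 1
        funext x
        exact com_cons ψ F _ _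
      have h₃ : ∀ x y, com ψ (fun z => F (coder σ b ψ (a :: x) :: z)) y =
          coder σ b (fun x' => com ψ (fun z => F (ψ (σ a :: x') :: z)) y) x +
          split (fun x₁ x₂ => com ψ (fun z => F (ψ (b (a :: x₁) :: x₂) :: z)) y) x := by
        intro x y
        rw [← comHead_apply hF, coder, map_add, map_coder, map_split]
        rfl
      rw [coder, h₂, coder_split]
      simp only [com_cons, h₁ _ [], h₃, split_add]
      rw [← split_split fun x y₁ y₂ => com ψ (fun z => F (ψ (b (a :: x) :: y₁) :: z)) y₂]
      abel
    have e₁ : com ψ (coder σ' b' F) (a :: w) = split (fun x y =>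
        com ψ (fun z => F (com ψ b' (a :: x) :: z)) y +
          com ψ (coder σ' b' fun z => F (σ' (ψ (a :: x)) :: z)) y) w := by
      have h₁ : ∀ x y, com ψ (fun z => coder σ' b' F (ψ (a :: x) :: z)) y =
          com ψ (coder σ' b' fun z => F (σ' (ψ (a :: x)) :: z)) y +
          split (fun y₁ y₂ => com ψ (fun x' =>
            com ψ (fun z => F (b' (ψ (a :: x) :: x') :: z)) y₂) y₁) y := by
        intro x y
        rw [← com_split, ← com_add]
        rfl
      have h₃ : ∀ x y, com ψ (fun z => F (com ψ b' (a :: x) :: z)) y =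
          split (fun x₁ x₂ => com ψ (fun x' =>
            com ψ (fun z => F (b' (ψ (a :: x₁) :: x') :: z)) y) x₂) x := by
        intro x y
        rw [← comHead_apply hF, com_cons, map_split]
        simp only [map_com, comHead_apply]
      rw [com_cons]
      simp only [h₁, h₃, split_add]
      rw [split_split fun x y₁ y₂ => com ψ (fun x' =>
            com ψ (fun z => F (b' (ψ (a :: x) :: x') :: z)) y₂) y₁]
      abel
    rw [e₀, e₁, ← split_sub, split_eq_last]
    · simp only [com, coder, add_zero]
      exact ((hF.head []).map_sub _ _).symm
    · intro x y hxy hy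
      have hy' : 0 < y.length := List.length_pos_iff.mpr hy
      have hl : x.length + y.length + 1 = n := by rw [← hn, ← hxy]; simp
      have i₁ := hX (a :: x) (by rw [hn]; simp; omega)
      have i₂ := ih y.length (by omega) (hF.cons (σ' (ψ (a :: x))))
        (fun z hz => hX z (by omega)) rfl
      rw [hX y (by omega), (hF.cons _).zero_cons, sub_eq_zero] at i₂
      rw [sub_eq_zero] at i₁
      rw [i₁, i₂, sub_self]

end square

/-- A grading on a module by submodules spanning it, with its parity involution. -/
structure Grad (K V : Type) [Field K] [AddCommGroup V] [Module K V] where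
  gr : ℤ → Submodule K V
  σ : V →ₗ[K] V
  span : ⨆ e, gr e = ⊤
  σ_gr : ∀ e, ∀ v ∈ gr e, σ v = (-1 : K) ^ e • v

/-- Homogeneity of degree `k` of a function on words. -/
def HDeg {V M : Type} [AddCommGroup V] [Module K V] [AddCommGroup M] [Module K M]
    (𝒱 : Grad K V) (ℳ : Grad K M) (k : ℤ) (F : List V → M) : Prop :=
  ∀ w es, List.Forall₂ (fun v e => v ∈ 𝒱.gr e) w es → F w ∈ ℳ.gr (es.sum + k)

section degree

variable {V W M N : Type} [AddCommGroup V] [Module K V] [AddCommGroup W] [Module K W]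
  [AddCommGroup M] [Module K M] [AddCommGroup N] [Module K N]
  {𝒱 : Grad K V} {𝒲 : Grad K W} {ℳ : Grad K M} {𝒩 : Grad K N}

theorem Grad.induction (𝒱 : Grad K V) {p : V → Prop} (h0 : p 0)
    (hadd : ∀ x y, p x → p y → p (x + y)) (hgr : ∀ e, ∀ v ∈ 𝒱.gr e, p v) (v : V) : p v :=
  Submodule.iSup_induction 𝒱.gr (motive := p) (𝒱.span ▸ Submodule.mem_top : v ∈ ⨆ e, 𝒱.gr e)
    hgr h0 hadd

theorem Grad.σ_mem (𝒱 : Grad K V) {e : ℤ} {v : V} (h : v ∈ 𝒱.gr e) : 𝒱.σ v ∈ 𝒱.gr e := by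
  rw [𝒱.σ_gr e v h]
  exact Submodule.smul_mem _ _ h

theorem Grad.ext_linear (𝒱 : Grad K V) {f g : V →ₗ[K] M}
    (h : ∀ e, ∀ v ∈ 𝒱.gr e, f v = g v) (v : V) : f v = g v :=
  𝒱.induction (by simp) (fun x y hx hy => by rw [map_add, map_add, hx, hy]) h v

theorem neg_one_zpow_mul_self (e : ℤ) : (-1 : K) ^ e * (-1 : K) ^ e = 1 := by
  rw [← mul_zpow]; simp

theorem Grad.σ_σ (𝒱 : Grad K V) (v : V) : 𝒱.σ (𝒱.σ v) = v := by
  refine 𝒱.ext_linear (f := 𝒱.σ ∘ₗ 𝒱.σ) (g := LinearMap.id) (fun e v hv => ?_) v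
  simp only [LinearMap.comp_apply, 𝒱.σ_gr e v hv, map_smul, smul_smul, neg_one_zpow_mul_self,
    one_smul, LinearMap.id_apply]

theorem HDeg.cons {k : ℤ} {F : List V → M} (h : HDeg 𝒱 ℳ k F) {e : ℤ} {a : V} (ha : a ∈ 𝒱.gr e) :
    HDeg 𝒱 ℳ (e + k) fun x => F (a :: x) := by
  intro w es hw
  have := h (a :: w) (e :: es) (List.Forall₂.cons ha hw)
  rw [List.sum_cons] at this
  convert this using 2
  ring

theorem HDeg.add {k : ℤ} {F G : List V → M} (hF : HDeg 𝒱 ℳ k F) (hG : HDeg 𝒱 ℳ k G) :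
    HDeg 𝒱 ℳ k fun x => F x + G x :=
  fun w es h => Submodule.add_mem _ (hF w es h) (hG w es h)

theorem HDeg.sub {k : ℤ} {F G : List V → M} (hF : HDeg 𝒱 ℳ k F) (hG : HDeg 𝒱 ℳ k G) :
    HDeg 𝒱 ℳ k fun x => F x - G x :=
  fun w es h => Submodule.sub_mem _ (hF w es h) (hG w es h)

theorem HDeg.map {k l m : ℤ} {F : List V → M} (hF : HDeg 𝒱 ℳ k F) {f : M →ₗ[K] N}
    (hf : ∀ e, ∀ x ∈ ℳ.gr e, f x ∈ 𝒩.gr (e + l)) (hm : k + l = m) :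
    HDeg 𝒱 𝒩 m fun x => f (F x) := by
  intro w es h
  have := hf _ _ (hF w es h)
  rwa [add_assoc, hm] at this

theorem HDeg.mapList {k : ℤ} {F : List V → M} (hF : HDeg 𝒱 ℳ k F) :
    HDeg 𝒱 ℳ k fun x => F (x.map 𝒱.σ) := by
  intro w es h
  refine hF _ es ?_
  rw [List.forall₂_map_left_iff]
  exact h.imp fun _ _ => 𝒱.σ_mem

/-- Homogeneous multilinear functions commute with the parity involutions up to sign. -/
theorem HDeg.parity {k : ℤ} {F : List V → M} (hF : HDeg 𝒱 ℳ k F) (hL : ML K F) (w : List V) :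
    F (w.map 𝒱.σ) = (-1 : K) ^ k • ℳ.σ (F w) := by
  induction w generalizing F k with
  | nil =>
    have h : F [] ∈ ℳ.gr k := by simpa using hF [] [] List.Forall₂.nil
    rw [List.map_nil, ℳ.σ_gr k _ h, smul_smul, neg_one_zpow_mul_self, one_smul]
  | cons a w ih =>
    refine 𝒱.ext_linear (f := hL.head (w.map 𝒱.σ) ∘ₗ 𝒱.σ)
      (g := ((-1 : K) ^ k • ℳ.σ) ∘ₗ hL.head w) (fun e v hv => ?_) a
    simp only [LinearMap.comp_apply, ML.head_apply, LinearMap.smul_apply]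
    rw [𝒱.σ_gr e v hv]
    have h1 := (hL.head (w.map 𝒱.σ)).map_smul ((-1 : K) ^ e) v
    simp only [ML.head_apply] at h1
    rw [h1, ih (hF.cons hv) (hL.cons v), smul_smul, zpow_add₀ (by simp), ← mul_assoc,
      neg_one_zpow_mul_self, one_mul]

theorem HDeg.split {k : ℤ} {H : List V → List V → M}
    (h : ∀ x y es fs, List.Forall₂ (fun v e => v ∈ 𝒱.gr e) x es →
      List.Forall₂ (fun v e => v ∈ 𝒱.gr e) y fs → H x y ∈ ℳ.gr (es.sum + fs.sum + k)) :
    HDeg 𝒱 ℳ k (split H) := by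
  intro w es hw
  induction hw generalizing H k with
  | nil => simpa [BarWords.split] using h [] [] [] [] .nil .nil
  | @cons a e w es ha hw ih =>
    refine Submodule.add_mem _ ?_ ?_
    · simpa using h [] (a :: w) [] (e :: es) .nil (.cons ha hw)
    · have := @ih (e + k) (fun x y => H (a :: x) y) fun x y es fs hx hy => by
        have := h (a :: x) y (e :: es) fs (.cons ha hx) hy
        rw [List.sum_cons] at this
        convert this using 2
        ring
      rw [List.sum_cons]
      convert this using 2
      ring

theorem HDeg.coder {k : ℤ} {F : List V → M} (hF : HDeg 𝒱 ℳ k F) {b : List V → V}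
    (hb : HDeg 𝒱 𝒱 1 b) : HDeg 𝒱 ℳ (k + 1) (coder 𝒱.σ b F) := by
  intro w es hw
  induction hw generalizing F k with
  | nil => exact Submodule.zero_mem _
  | @cons a e w es ha hw ih =>
    refine Submodule.add_mem _ ?_ ?_
    · have := ih (hF.cons (𝒱.σ_mem ha))
      rw [List.sum_cons]
      convert this using 2
      ring
    · have := HDeg.split (𝒱 := 𝒱) (ℳ := ℳ) (k := e + k + 1) (H := fun x y => F (b (a :: x) :: y))
        (fun x y es fs hx hy => by
          have := hF _ _ (.cons (hb _ _ (.cons ha hx)) hy)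
          rw [List.sum_cons, List.sum_cons] at this
          convert this using 2
          ring) w es hw
      rw [List.sum_cons]
      convert this using 2
      ring

theorem HDeg.comAux {k : ℤ} {F : List W → M} (hF : HDeg 𝒲 ℳ k F) {ψ : List V → W}
    (hψ : HDeg 𝒱 𝒲 0 ψ) {c : List V} {cs : List ℤ}
    (hc : List.Forall₂ (fun v e => v ∈ 𝒱.gr e) c cs) :
    HDeg 𝒱 ℳ (cs.sum + k) (comAux ψ F c) := by
  intro w es hw
  have hψc : ∀ {c : List V} {cs : List ℤ}, List.Forall₂ (fun v e => v ∈ 𝒱.gr e) c cs →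
      ψ c ∈ 𝒲.gr cs.sum := fun h => by simpa using hψ _ _ h
  induction hw generalizing F k c cs with
  | nil => simpa [BarWords.comAux] using hF _ _ (.cons (hψc hc) .nil)
  | @cons a e w es ha hw ih =>
    refine Submodule.add_mem _ ?_ ?_
    · have := ih hF (List.rel_append hc (.cons ha .nil))
      rw [List.sum_append, List.sum_cons, List.sum_nil] at this
      rw [List.sum_cons]
      convert this using 2
      ring
    · have := ih (hF.cons (hψc hc)) (.cons ha .nil)
      rw [List.sum_cons, List.sum_nil] at this
      rw [List.sum_cons]
      convert this using 2
      ring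

theorem HDeg.com {k : ℤ} {F : List W → M} (hF : HDeg 𝒲 ℳ k F) {ψ : List V → W}
    (hψ : HDeg 𝒱 𝒲 0 ψ) : HDeg 𝒱 ℳ k (com ψ F) := by
  rintro (_ | ⟨a, w⟩) es hw
  · cases hw
    exact hF [] [] .nil
  · cases hw with
    | @cons _ e _ es ha hw =>
    have := HDeg.comAux hF hψ (.cons ha .nil) w es hw
    rw [List.sum_cons, List.sum_nil] at this
    rw [List.sum_cons]
    change BarWords.comAux ψ F [a] w ∈ _
    convert this using 2
    ring

end degree

/-- Solution of a fixed point equation in which the value on a word only depends on the values on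
shorter words. -/
theorem exists_fixed {α M : Type} [AddCommGroup M] {p : (List α → M) → Prop}
    (hp : ∀ F, (∀ n, ∃ G, p G ∧ ∀ w, w.length ≤ n → F w = G w) → p F)
    (h0 : p fun _ => 0) {Φ : (List α → M) → List α → M} (hΦ : ∀ F, p F → p (Φ F))
    (hc : ∀ F G, p F → p G → ∀ w, (∀ x, x.length < w.length → F x = G x) → Φ F w = Φ G w) :
    ∃ F, p F ∧ ∀ w, F w = Φ F w := by
  have hit : ∀ n, p (Φ^[n] fun _ => 0) := by
    intro n
    induction n with
    | zero => exact h0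
    | succ n ih => rw [Function.iterate_succ_apply']; exact hΦ _ ih
  have key : ∀ n k w, w.length < n → (Φ^[n] fun _ => 0) w = (Φ^[n + k] fun _ => 0) w := by
    intro n
    induction n with
    | zero => intro k w h; omega
    | succ n ih =>
      intro k w h
      rw [show n + 1 + k = (n + k) + 1 by omega, Function.iterate_succ_apply',
        Function.iterate_succ_apply']
      exact hc _ _ (hit _) (hit _) w fun x hx => ih k x (by omega)
  have key' : ∀ n w, w.length < n →
      (Φ^[w.length + 1] fun _ => 0) w = (Φ^[n] fun _ => 0) w := by
    intro n w h
    rw [key (w.length + 1) (n - (w.length + 1)) w (by omega)]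
    rw [show w.length + 1 + (n - (w.length + 1)) = n by omega]
  have hF : p fun w => (Φ^[w.length + 1] fun _ => 0) w :=
    hp _ fun n => ⟨_, hit (n + 1), fun w hw => key' (n + 1) w (by omega)⟩
  refine ⟨_, hF, fun w => ?_⟩
  rw [Function.iterate_succ_apply']
  exact hc _ _ (hit _) hF w fun x hx => (key' _ x hx).symm

section aux

variable {V W M : Type} [AddCommGroup V] [Module K V] [AddCommGroup W] [Module K W]
  [AddCommGroup M] [Module K M] {𝒱 : Grad K V} {ℳ : Grad K M}

theorem ML.of_local {F : List V → M}
    (h : ∀ n, ∃ G : List V → M, ML K G ∧ ∀ w, w.length ≤ n → F w = G w) : ML K F := by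
  constructor
  · intro u v x y
    obtain ⟨G, hG, e⟩ := h (u.length + v.length + 1)
    rw [e _ (by simp; omega), e _ (by simp; omega), e _ (by simp; omega), hG.1]
  · intro u v c x
    obtain ⟨G, hG, e⟩ := h (u.length + v.length + 1)
    rw [e _ (by simp; omega), e _ (by simp; omega), hG.2]

theorem HDeg.of_local {k : ℤ} {F : List V → M}
    (h : ∀ n, ∃ G : List V → M, HDeg 𝒱 ℳ k G ∧ ∀ w, w.length ≤ n → F w = G w) :
    HDeg 𝒱 ℳ k F := by
  intro w es hw
  obtain ⟨G, hG, e⟩ := h w.length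
  rw [e w le_rfl]
  exact hG w es hw

variable (K) in
theorem ML.zero : ML K fun _ : List V => (0 : M) :=
  ⟨fun _ _ _ _ => (add_zero 0).symm, fun _ _ c _ => (smul_zero c).symm⟩

theorem HDeg.zero {k : ℤ} : HDeg 𝒱 ℳ k fun _ => 0 := fun _ _ _ => Submodule.zero_mem _

/-- The extension by zero of a function on letters to words. -/
def letter {V M : Type} [AddCommGroup M] (f : V → M) : List V → M
  | [] => 0
  | [v] => f v
  | _ :: _ :: _ => 0

theorem ML.letter (f : V →ₗ[K] M) : ML K (letter f) := by
  constructor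
  · rintro (_ | ⟨a, _ | ⟨a', u⟩⟩) (_ | ⟨c, v⟩) x y <;> simp [BarWords.letter]
  · rintro (_ | ⟨a, _ | ⟨a', u⟩⟩) (_ | ⟨c, v⟩) k x <;> simp [BarWords.letter]

theorem HDeg.letter {f : V →ₗ[K] M} (hf : ∀ e, ∀ x ∈ 𝒱.gr e, f x ∈ ℳ.gr e) :
    HDeg 𝒱 ℳ 0 (letter f) := by
  intro w es hw
  match hw with
  | .nil => exact Submodule.zero_mem _
  | .cons h .nil => simpa [BarWords.letter] using hf _ _ h
  | .cons _ (.cons _ _) => exact Submodule.zero_mem _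

theorem letter_cons_of_ne {V M : Type} [AddCommGroup M] (f : V → M) (v : V) {y : List V}
    (hy : y ≠ []) : letter f (v :: y) = 0 := by
  cases y with
  | nil => exact absurd rfl hy
  | cons => rfl

theorem coder_of_cons {V : Type} {σ : V → V} {b : List V → V} {F : List V → M}
    (h : ∀ a x, F (a :: x) = 0) (w : List V) : coder σ b F w = 0 := by
  cases w with
  | nil => rfl
  | cons a w => simp only [coder, h, coder_zero, split_zero, add_zero]

theorem coder_letter (σ : V → V) {b : List V → V} (hb : b [] = 0) (f : V →ₗ[K] M)
    (w : List V) : coder σ b (letter f) w = f (b w) := by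
  cases w with
  | nil => simp [coder, hb]
  | cons a w =>
    rw [coder, coder_of_cons (fun _ _ => rfl), zero_add,
      split_eq_last fun x y _ hy => letter_cons_of_ne f _ hy]
    rfl

theorem com_letter {V : Type} (ψ : List V → W) (f : W →ₗ[K] M) (a : V) (w : List V) :
    com ψ (letter f) (a :: w) = f (ψ (a :: w)) := by
  rw [com_cons, split_eq_last]
  · rfl
  · intro x y _ hy
    obtain ⟨c, y, rfl⟩ := List.exists_cons_of_ne_nil hy
    rw [com_cons]
    exact split_eq_zero fun _ _ _ => com_zero ψ _

/-- The restriction of a function on words to words with at least two letters. -/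
def trunc (F : List V → M) (w : List V) : M := if w.length ≤ 1 then 0 else F w

theorem ML.trunc {F : List V → M} (hF : ML K F) : ML K (trunc F) := by
  constructor
  · intro u v x y
    by_cases h : u.length + (v.length + 1) ≤ 1 <;> simp [BarWords.trunc, h, hF.1]
  · intro u v c x
    by_cases h : u.length + (v.length + 1) ≤ 1 <;> simp [BarWords.trunc, h, hF.2]

theorem HDeg.trunc {k : ℤ} {F : List V → M} (hF : HDeg 𝒱 ℳ k F) : HDeg 𝒱 ℳ k (trunc F) := by
  intro w es hw
  unfold BarWords.trunc
  split_ifs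
  · exact Submodule.zero_mem _
  · exact hF w es hw

theorem com_eq_trunc {V W M : Type} [AddCommGroup W] [Module K W] [AddCommGroup M] [Module K M]
    (ψ : List V → W) {F : List W → M} {f : W →ₗ[K] M} (h1 : ∀ v, F [v] = f v)
    (a : V) (w : List V) : com ψ F (a :: w) = f (ψ (a :: w)) + com ψ (trunc F) (a :: w) := by
  have h : F = fun x => letter f x + (trunc F x + if x = [] then F [] else 0) := by
    funext x
    match x with
    | [] => simp [letter, trunc]
    | [v] => simp [letter, trunc, h1]
    | _ :: _ :: _ => simp [letter, trunc]
  have h' : com ψ (fun x : List W => if x = [] then F [] else 0) (a :: w) = 0 := by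
    rw [com_cons]
    simp only [reduceCtorEq, if_false, com_zero, split_zero]
  conv_lhs => rw [h]
  rw [com_add, com_add, com_letter, h', add_zero]

theorem com_trunc_congr {V W M : Type} [AddCommGroup M] {ψ ψ' : List V → W} {F : List W → M} {w : List V}
    (h : ∀ x, x.length < w.length → ψ x = ψ' x) : com ψ (trunc F) w = com ψ' (trunc F) w := by
  have key : ∀ n (w : List V), w.length ≤ n → (∀ x, x.length ≤ n → ψ x = ψ' x) →
      ∀ G : List W → M, com ψ G w = com ψ' G w := by
    intro n
    induction n with
    | zero =>
      intro w hw _ G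
      rw [List.length_eq_zero_iff.mp (Nat.le_zero.mp hw)]
      rfl
    | succ n ih =>
      rintro (_ | ⟨a, w⟩) hw he G
      · rfl
      · rw [com_cons, com_cons]
        refine split_congr fun x y hxy => ?_
        have hl : x.length + y.length = w.length := by rw [← hxy]; simp
        rw [List.length_cons] at hw
        rw [he (a :: x) (by simp; omega),
          ih y (by omega) (fun x hx => he x (by omega))]
  cases w with
  | nil => rfl
  | cons a w =>
    rw [com_cons, com_cons]
    refine split_congr fun x y hxy => ?_
    have hl : x.length + y.length = w.length := by rw [← hxy]; simp
    by_cases hy : y = []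
    · subst hy
      rfl
    · have := List.length_pos_iff.mpr hy
      rw [h (a :: x) (by simp; omega)]
      exact key y.length y le_rfl (fun x hx => h x (by simp; omega)) _

end aux

/-- The operations of a differential graded algebra, written on its suspension. -/
structure DGOps {A : Type} [AddCommGroup A] [Module K A] (𝒜 : Grad K A) where
  d : A →ₗ[K] A
  μ : A →ₗ[K] A →ₗ[K] A
  d_d : ∀ x, d (d x) = 0
  d_μ : ∀ x y, d (μ x y) = -μ (d x) y - μ (𝒜.σ x) (d y)
  μ_μ : ∀ x y z, μ (μ x y) z = -μ (𝒜.σ x) (μ y z)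
  d_gr : ∀ e, ∀ x ∈ 𝒜.gr e, d x ∈ 𝒜.gr (e + 1)
  μ_gr : ∀ e f, ∀ x ∈ 𝒜.gr e, ∀ y ∈ 𝒜.gr f, μ x y ∈ 𝒜.gr (e + f + 1)

/-- A contraction of a differential graded algebra onto a graded vector space. -/
structure Contraction {V A : Type} [AddCommGroup V] [Module K V] [AddCommGroup A] [Module K A]
    (𝒱 : Grad K V) {𝒜 : Grad K A} (D : DGOps 𝒜) where
  i : V →ₗ[K] A
  p : A →ₗ[K] V
  h : A →ₗ[K] A
  i_gr : ∀ e, ∀ x ∈ 𝒱.gr e, i x ∈ 𝒜.gr e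
  p_gr : ∀ e, ∀ x ∈ 𝒜.gr e, p x ∈ 𝒱.gr e
  h_gr : ∀ e, ∀ x ∈ 𝒜.gr e, h x ∈ 𝒜.gr (e + -1)
  d_i : ∀ x, D.d (i x) = 0
  p_d : ∀ x, p (D.d x) = 0
  p_i : ∀ x, p (i x) = x
  homotopy : ∀ x, D.d (h x) + h (D.d x) = i (p x) - x

section star

variable {V W A : Type} [AddCommGroup A] [Module K A] {𝒜 : Grad K A} (D : DGOps 𝒜)

/-- The convolution product of functions on words with values in an algebra. -/
def star : (List V → A) →ₗ[K] (List V → A) →ₗ[K] (List V → A) :=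
  LinearMap.mk₂ K (fun F G w => split (fun x y => D.μ (F x) (G y)) w)
    (fun F F' G => by
      funext w
      simp only [Pi.add_apply, map_add, LinearMap.add_apply, split_add])
    (fun c F G => by
      funext w
      simp only [Pi.smul_apply, map_smul, LinearMap.smul_apply, split_smul])
    (fun F G G' => by
      funext w
      simp only [Pi.add_apply, map_add, split_add])
    (fun c F G => by
      funext w
      simp only [Pi.smul_apply, map_smul, split_smul])

theorem star_apply (F G : List V → A) (w : List V) :
    star D F G w = split (fun x y => D.μ (F x) (G y)) w := rfl

/-- `coder` as a linear map. -/
def coderL {V M : Type} [AddCommGroup M] [Module K M] (σ : V → V) (b : List V → V) :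
    (List V → M) →ₗ[K] (List V → M) where
  toFun F := coder σ b F
  map_add' F G := funext fun w => coder_add σ b F G w
  map_smul' c F := funext fun w => coder_smul c σ b F w

theorem coderL_apply {V M : Type} [AddCommGroup M] [Module K M] (σ : V → V) (b : List V → V)
    (F : List V → M) : coderL (K := K) σ b F = coder σ b F := rfl

theorem d_star (F G : List V → A) :
    D.d.compLeft (List V) (star D F G) = -star D (D.d.compLeft (List V) F) G -
      star D (𝒜.σ.compLeft (List V) F) (D.d.compLeft (List V) G) := by
  funext w
  change D.d (split _ w) = -split _ w - split _ w
  rw [map_split, ← split_neg, ← split_sub]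
  exact split_congr fun x y _ => D.d_μ _ _

theorem star_star (F G H : List V → A) :
    star D (star D F G) H = -star D (𝒜.σ.compLeft (List V) F) (star D G H) := by
  funext w
  change split _ w = -split _ w
  have e₁ : ∀ x y : List V, D.μ (star D F G x) (H y) =
      split (fun x₁ x₂ => D.μ (D.μ (F x₁) (G x₂)) (H y)) x := fun x y =>
    map_split (D.μ.flip (H y)) _ x
  have e₂ : ∀ x y : List V, D.μ (𝒜.σ.compLeft (List V) F x) (star D G H y) =
      split (fun y₁ y₂ => D.μ (𝒜.σ (F x)) (D.μ (G y₁) (H y₂))) y := fun x y =>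
    map_split (D.μ (𝒜.σ (F x))) _ y
  simp only [e₁, e₂]
  rw [split_split fun x₁ x₂ y => D.μ (D.μ (F x₁) (G x₂)) (H y), ← split_neg]
  simp only [← split_neg, D.μ_μ]

theorem star_map (f : V → V) (F G : List V → A) :
    LinearMap.funLeft K A (List.map f) (star D F G) =
      star D (LinearMap.funLeft K A (List.map f) F) (LinearMap.funLeft K A (List.map f) G) :=
  funext fun w => split_map f (fun x y => D.μ (F x) (G y)) w

theorem com_star (ψ : List V → W) (F G : List W → A) :
    com ψ (star D F G) = star D (com ψ F) (com ψ G) := by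
  funext w
  refine (com_split ψ (fun x y => D.μ (F x) (G y)) w).trans (split_congr fun x y _ => ?_)
  simp only [← map_com ψ (D.μ _)]
  exact (map_com ψ (D.μ.flip (com ψ G y)) F x).symm

theorem star_congr {F F' G G' : List V → A} (hF : F [] = 0) (hF' : F' [] = 0) (hG : G [] = 0)
    (hG' : G' [] = 0) {w : List V} (h₁ : ∀ x, x.length < w.length → F x = F' x)
    (h₂ : ∀ x, x.length < w.length → G x = G' x) : star D F G w = star D F' G' w := by
  refine split_congr fun x y hxy => ?_
  have hl : x.length + y.length = w.length := by rw [← hxy]; simp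
  rcases x with _ | ⟨a, x⟩
  · simp [hF, hF']
  · rcases y with _ | ⟨c, y⟩
    · simp [hG, hG']
    · simp only [List.length_cons] at hl
      rw [h₁ _ (by simp; omega), h₂ _ (by simp; omega)]

theorem star_nil {F G : List V → A} (hF : F [] = 0) : star D F G [] = 0 := by
  simp [star_apply, split, hF]

theorem star_nil' {F G : List V → A} (hG : G [] = 0) : star D F G [] = 0 := by
  simp [star_apply, split, hG]

theorem star_eq_zero_left {F G : List V → A} (hG : G [] = 0) {w : List V}
    (h : ∀ x, x.length < w.length → F x = 0) : star D F G w = 0 := by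
  refine split_eq_zero fun x y hxy => ?_
  have hl : x.length + y.length = w.length := by rw [← hxy]; simp
  rcases y with _ | ⟨c, y⟩
  · simp [hG]
  · rw [h _ (by simp only [List.length_cons] at hl; omega)]
    simp

theorem star_eq_zero_right {F G : List V → A} (hF : F [] = 0) {w : List V}
    (h : ∀ x, x.length < w.length → G x = 0) : star D F G w = 0 := by
  refine split_eq_zero fun x y hxy => ?_
  have hl : x.length + y.length = w.length := by rw [← hxy]; simp
  rcases x with _ | ⟨c, x⟩
  · simp [hF]
  · rw [h _ (by simp only [List.length_cons] at hl; omega)]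
    simp

variable [AddCommGroup V] [Module K V] {𝒱 : Grad K V}

theorem coderL_star {b : List V → V} (F G : List V → A) :
    coderL (K := K) 𝒱.σ b (star D F G) = star D (coderL (K := K) 𝒱.σ b F) G +
      star D (LinearMap.funLeft K A (List.map 𝒱.σ) F) (coderL (K := K) 𝒱.σ b G) := by
  funext w
  refine (coder_split 𝒱.σ b (fun x y => D.μ (F x) (G y)) w).trans ?_
  rw [split_add]
  refine congrArg₂ (· + ·) (split_congr fun x y _ => ?_) (split_congr fun x y _ => ?_)
  · exact (map_coder 𝒱.σ b (D.μ.flip (G y)) F x).symm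
  · exact (map_coder 𝒱.σ b (D.μ (F (x.map 𝒱.σ))) G y).symm

theorem ML.star {F G : List V → A} (hF : ML K F) (hG : ML K G) : ML K (star D F G) :=
  ML.split (H := fun x y => D.μ (F x) (G y)) (fun y => hF.map (D.μ.flip (G y)))
    (fun x => hG.map (D.μ (F x)))

theorem HDeg.star {k l m : ℤ} {F G : List V → A} (hF : HDeg 𝒱 𝒜 k F) (hG : HDeg 𝒱 𝒜 l G)
    (hm : k + l + 1 = m) : HDeg 𝒱 𝒜 m (star D F G) :=
  HDeg.split (H := fun x y => D.μ (F x) (G y)) fun x y es fs hx hy => by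
    have := D.μ_gr _ _ _ (hF x es hx) _ (hG y fs hy)
    convert this using 2
    rw [← hm]
    ring

end star

section transfer

variable {V A : Type} [AddCommGroup V] [Module K V]
  [AddCommGroup A] [Module K A] {𝒱 : Grad K V} {𝒜 : Grad K A} {D : DGOps 𝒜}

/-- A twisting datum: a multilinear function `F` of degree `0` and a coderivation `b` of degree `1`
without linear part satisfying the equation of an `A∞`-morphism to a dg-algebra. -/
structure Twist (𝒱 : Grad K V) (D : DGOps 𝒜) (F : List V → A) (b : List V → V) : Prop where
  F_ml : ML K F
  b_ml : ML K b
  F_deg : HDeg 𝒱 𝒜 0 F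
  b_deg : HDeg 𝒱 𝒱 1 b
  F_nil : F [] = 0
  b_nil : b [] = 0
  b_one : ∀ v, b [v] = 0
  b_b : ∀ w, coder 𝒱.σ b b w = 0
  eqn : ∀ w, coder 𝒱.σ b F w = D.d (F w) + star D F F w

/-- Homotopy transfer of a differential graded algebra structure along a contraction. -/
theorem Contraction.exists_twist (C : Contraction 𝒱 D) :
    ∃ F b, Twist 𝒱 D F b ∧ (∀ v, F [v] = C.i v) ∧
      ∀ v v', b [v, v'] = C.p (D.μ (C.i v) (C.i v')) := by
  obtain ⟨F, ⟨hF, hd, h0⟩, hfix⟩ := exists_fixed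
    (p := fun F : List V → A => ML K F ∧ HDeg 𝒱 𝒜 0 F ∧ F [] = 0)
    (fun F h => ⟨ML.of_local fun n => let ⟨G, hG, e⟩ := h n; ⟨G, hG.1, e⟩,
      HDeg.of_local fun n => let ⟨G, hG, e⟩ := h n; ⟨G, hG.2.1, e⟩,
      let ⟨_, hG, e⟩ := h 0; (e [] le_rfl).trans hG.2.2⟩)
    ⟨ML.zero K, HDeg.zero, rfl⟩
    (Φ := fun F w => letter C.i w + C.h (star D F F w))
    (fun F ⟨hF, hd, h0⟩ => ⟨(ML.letter _).add ((ML.star D hF hF).map _),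
      (HDeg.letter C.i_gr).add ((HDeg.star D hd hd rfl).map C.h_gr (by norm_num)),
      by simp [letter, star_nil D h0]⟩)
    (fun F G hF hG w h => by
      simp only [star_congr D hF.2.2 hG.2.2 hF.2.2 hG.2.2 h h])
  have hQ : ML K (star D F F) := ML.star D hF hF
  have hQd : HDeg 𝒱 𝒜 1 (star D F F) := HDeg.star D hd hd rfl
  have hQ0 : star D F F [] = 0 := star_nil D h0
  have hQ1 : ∀ v, star D F F [v] = 0 := fun v => by
    simp [star_apply, split, h0]
  set b : List V → V := fun w => C.p (star D F F w) with hb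
  have hone : ∀ v, F [v] = C.i v := fun v => by
    rw [hfix, hQ1, map_zero, add_zero]; rfl
  have hp : ∀ x, LinearMap.funLeft K A (List.map 𝒱.σ) F x = 𝒜.σ.compLeft (List V) F x :=
    fun x => by simpa [LinearMap.funLeft_apply] using hd.parity hF x
  set E : List V → A := coderL (K := K) 𝒱.σ b F - D.d.compLeft (List V) F - star D F F with hE
  have hcF : coderL (K := K) 𝒱.σ b F = D.d.compLeft (List V) F + star D F F + E := by
    rw [hE]; abel
  have hdQ : coderL (K := K) 𝒱.σ b (star D F F) + D.d.compLeft (List V) (star D F F) =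
      star D E F + star D (𝒜.σ.compLeft (List V) F) E := by
    rw [coderL_star, d_star, funext hp, hcF]
    simp only [map_add, LinearMap.add_apply, star_star]
    abel
  have hE0 : ∀ n, ∀ w : List V, w.length = n → E w = 0 := by
    intro n
    induction n using Nat.strong_induction_on with
    | _ n ih =>
    intro w hw
    have h1 : coder 𝒱.σ b (star D F F) w = -D.d (star D F F w) := by
      rw [eq_neg_iff_add_eq_zero]
      refine (congrFun hdQ w).trans ?_
      rw [Pi.add_apply, star_eq_zero_left D h0 fun x hx => ih _ (hw ▸ hx) x rfl,
        star_eq_zero_right D (by simp [h0]) fun x hx => ih _ (hw ▸ hx) x rfl, add_zero]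
    have h2 : coder 𝒱.σ b F w = C.i (b w) + C.h (coder 𝒱.σ b (star D F F) w) := by
      have : F = fun x => letter C.i x + C.h (star D F F x) := funext hfix
      conv_lhs => rw [this]
      rw [coder_add, coder_letter _ (by simp [hb, hQ0]), map_coder]
    have h3 : D.d (F w) = D.d (C.h (star D F F w)) := by
      rw [hfix w, map_add]
      have : D.d (letter C.i w) = 0 := by
        rcases w with _ | ⟨a, _ | ⟨c, w⟩⟩
        · exact map_zero _
        · exact C.d_i a
        · exact map_zero _
      rw [this, zero_add]
    change coder 𝒱.σ b F w - D.d (F w) - star D F F w = 0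
    have h4 := C.homotopy (star D F F w)
    rw [h2, h1, h3, map_neg, hb]
    rw [eq_sub_iff_add_eq] at h4
    rw [← h4]
    abel
  have hE' : E = 0 := funext fun w => hE0 _ w rfl
  refine ⟨F, b, ⟨hF, hQ.map _, hd, hQd.map (l := 0) (fun e x hx => by
    simpa using C.p_gr e x hx) rfl, h0, by simp [hb, hQ0], fun v => by simp [hb, hQ1], ?_, ?_⟩,
    hone, ?_⟩
  · intro w
    rw [hE', map_zero, map_zero, LinearMap.zero_apply, add_zero, add_eq_zero_iff_eq_neg] at hdQ
    have := congrArg C.p (congrFun hdQ w)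
    rw [coderL_apply, map_coder, Pi.neg_apply, map_neg] at this
    rw [this]
    exact neg_eq_zero.mpr (C.p_d _)
  · intro w
    have := congrFun hcF w
    rwa [hE', add_zero] at this
  · intro v v'
    simp [hb, star_apply, split, h0, hone]

/-- Two twisting data over the same algebra, the second of which has a contraction as linear part,
are related by a morphism of `A∞`-algebras. -/
theorem Twist.exists_morphism {F F' : List V → A} {b b' : List V → V} (T : Twist 𝒱 D F b)
    (T' : Twist 𝒱 D F' b') (C : Contraction 𝒱 D) (hi : ∀ v, F' [v] = C.i v) :
    ∃ ψ : List V → V, ML K ψ ∧ HDeg 𝒱 𝒱 0 ψ ∧ ψ [] = 0 ∧ (∀ v, ψ [v] = C.p (F [v])) ∧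
      ∀ w, coder 𝒱.σ b ψ w = com ψ b' w := by
  have hψm : ∀ {Z : List V → A}, ML K Z → ML K fun w => C.p (Z w) := fun hZ => hZ.map _
  have hψd : ∀ {Z : List V → A}, HDeg 𝒱 𝒜 0 Z → HDeg 𝒱 𝒱 0 fun w => C.p (Z w) :=
    fun hZ => hZ.map (l := 0) (fun e x hx => by simpa using C.p_gr e x hx) rfl
  have hGm : ∀ {Z : List V → A}, ML K Z → ML K fun w => -C.h (Z w) := fun hZ => hZ.map (-C.h)
  have hGd : ∀ {Z : List V → A}, HDeg 𝒱 𝒜 0 Z → HDeg 𝒱 𝒜 (-1) fun w => -C.h (Z w) :=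
    fun hZ => hZ.map (f := -C.h) (l := -1)
      (fun e x hx => Submodule.neg_mem _ (C.h_gr e x hx)) (by norm_num)
  let t := LinearMap.funLeft K A (List.map 𝒱.σ)
  obtain ⟨Z, ⟨hZ, hZd, hZ0⟩, hfix⟩ := exists_fixed
    (p := fun Z : List V → A => ML K Z ∧ HDeg 𝒱 𝒜 0 Z ∧ Z [] = 0)
    (fun F h => ⟨ML.of_local fun n => let ⟨G, hG, e⟩ := h n; ⟨G, hG.1, e⟩,
      HDeg.of_local fun n => let ⟨G, hG, e⟩ := h n; ⟨G, hG.2.1, e⟩,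
      let ⟨_, hG, e⟩ := h 0; (e [] le_rfl).trans hG.2.2⟩)
    ⟨ML.zero K, HDeg.zero, rfl⟩
    (Φ := fun Z w => F w - com (fun x => C.p (Z x)) (trunc F') w -
      star D (fun x => -C.h (Z x)) F w -
      star D (t (com (fun x => C.p (Z x)) F')) (fun x => -C.h (Z x)) w -
      coder 𝒱.σ b (fun x => -C.h (Z x)) w)
    (fun Z ⟨hZ, hd, h0⟩ => ⟨(((T.F_ml.sub (ML.com T'.F_ml.trunc (hψm hZ))).sub
        (ML.star D (hGm hZ) T.F_ml)).sub
        (ML.star D ((ML.com T'.F_ml (hψm hZ)).mapList 𝒱.σ) (hGm hZ))).sub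
        (ML.coder (hGm hZ) T.b_ml 𝒱.σ),
      (((T.F_deg.sub (HDeg.com T'.F_deg.trunc (hψd hd))).sub
        (HDeg.star D (hGd hd) T.F_deg (by norm_num))).sub
        (HDeg.star D (HDeg.com T'.F_deg (hψd hd)).mapList (hGd hd) (by norm_num))).sub
        (HDeg.coder (hGd hd) T.b_deg), by
        beta_reduce
        rw [star_nil' D T.F_nil, star_nil' D (by simp [h0])]
        simp [T.F_nil, com, trunc, coder]⟩)
    (fun Z Z' hZ hZ' w h => by
      have e : ∀ x, x.length < w.length → C.p (Z x) = C.p (Z' x) := fun x hx => by rw [h x hx]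
      have e' : ∀ x, x.length < w.length → -C.h (Z x) = -C.h (Z' x) :=
        fun x hx => by rw [h x hx]
      have n₁ : -C.h (Z []) = 0 := by simp [hZ.2.2]
      have n₂ : -C.h (Z' []) = 0 := by simp [hZ'.2.2]
      have n₃ : ∀ Z : List V → A, t (com (fun x => C.p (Z x)) F') [] = 0 := fun Z => T'.F_nil
      have e₃ : ∀ x : List V, x.length < w.length →
          t (com (fun x => C.p (Z x)) F') x = t (com (fun x => C.p (Z' x)) F') x := by
        intro x hx
        change com _ F' (x.map 𝒱.σ) = com _ F' (x.map 𝒱.σ)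
        rw [← List.length_map (f := 𝒱.σ)] at hx
        generalize x.map 𝒱.σ = x at hx
        rcases x with _ | ⟨a, x⟩
        · rfl
        · rw [com_eq_trunc _ hi, com_eq_trunc _ hi, e _ hx,
            com_trunc_congr fun y hy => e y (hy.trans hx)]
      have := com_trunc_congr (F := F') e
      simp only [this, star_congr D n₁ n₂ T.F_nil T.F_nil e' fun _ _ => rfl,
        star_congr D (n₃ Z) (n₃ Z') n₁ n₂ e₃ e',
        coder_congr 𝒱.σ T.b_one (hGm hZ.1) (hGm hZ'.1) e'])
  set ψ : List V → V := fun x => C.p (Z x) with hψ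
  set G : List V → A := fun x => -C.h (Z x) with hG
  have mψ : ML K ψ := hψm hZ
  have mG : ML K G := hGm hZ
  have dψ : HDeg 𝒱 𝒱 0 ψ := hψd hZd
  have dG : HDeg 𝒱 𝒜 (-1) G := hGd hZd
  have hG0 : G [] = 0 := by simp [hG, hZ0]
  have hψ0 : ψ [] = 0 := by simp [hψ, hZ0]
  have bpar : ∀ w, b (w.map 𝒱.σ) = -𝒱.σ (b w) := fun w => by
    simpa using T.b_deg.parity T.b_ml w
  have ψpar : ∀ w, ψ (w.map 𝒱.σ) = 𝒱.σ (ψ w) := fun w => by simpa using dψ.parity mψ w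
  set P : List V → A := com ψ F' with hP
  have mP : ML K P := ML.com T'.F_ml mψ
  have dP : HDeg 𝒱 𝒜 0 P := HDeg.com T'.F_deg dψ
  have hP0 : P [] = 0 := T'.F_nil
  have Ppar : 𝒜.σ.compLeft (List V) P = t P := funext fun w => by
    simpa [t, LinearMap.funLeft_apply] using (dP.parity mP w).symm
  have Gpar : 𝒜.σ.compLeft (List V) G = -t G := funext fun w => by
    have := dG.parity mG w
    simp only [zpow_neg, zpow_one, inv_neg, inv_one, neg_smul, one_smul] at this
    simp [t, LinearMap.funLeft_apply, this]
  have tt : ∀ Q, t (t Q) = Q := fun Q => funext fun w => by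
    change Q ((w.map 𝒱.σ).map 𝒱.σ) = Q w
    rw [List.map_map, show (𝒱.σ ∘ 𝒱.σ : V → V) = id from funext 𝒱.σ_σ, List.map_id]
  have stP : 𝒜.σ.compLeft (List V) (t P) = P := by
    rw [← Ppar]; exact funext fun w => 𝒜.σ_σ _
  set c := coderL (K := K) (M := A) 𝒱.σ b with hc
  set δ := D.d.compLeft (List V) with hδ
  have ct : c (t P) = -t (c P) := funext fun w => coder_map bpar mP w
  have cc : c (c G) = 0 := funext fun w => coder_coder 𝒱.σ_σ bpar T.b_b mG w
  have cδ : c (δ G) = δ (c G) := funext fun w => (map_coder 𝒱.σ b D.d G w).symm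
  have δδ : δ (δ G) = 0 := funext fun w => D.d_d _
  have δt : δ (t P) = t (δ P) := rfl
  have cF : c F = δ F + star D F F := funext T.eqn
  set X : List V → A := c P - δ P - star D P P with hX
  have cP : c P = δ P + star D P P + X := by rw [hX]; abel
  set U : List V → A := F - P - star D G F - star D (t P) G - c G - δ G with hU
  have main : c U - δ U = star D U F + star D P U - X + star D (t X) G := by
    have e₁ : c (star D G F) = star D (c G) F + star D (t G) (c F) := coderL_star D G F
    have e₂ : c (star D (t P) G) = star D (c (t P)) G + star D (t (t P)) (c G) :=
      coderL_star D (t P) G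
    have e₃ : δ (star D G F) = -star D (δ G) F - star D (𝒜.σ.compLeft (List V) G) (δ F) :=
      d_star D G F
    have e₄ : δ (star D (t P) G) =
        -star D (δ (t P)) G - star D (𝒜.σ.compLeft (List V) (t P)) (δ G) := d_star D (t P) G
    have e₅ : t (star D P P) = star D (t P) (t P) := star_map D _ P P
    rw [hU]
    simp only [map_sub, e₁, e₂, e₃, e₄, ct, cF, cP, cc, cδ, δδ, δt, tt, Gpar, stP, e₅, map_add,
      map_neg, LinearMap.add_apply, LinearMap.sub_apply, LinearMap.neg_apply, star_star]
    abel
  have hUZ : ∀ w, U w = Z w - C.i (ψ w) - D.d (G w) := by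
    intro w
    have hz := hfix w
    have hp : P w = C.i (ψ w) + com ψ (trunc F') w := by
      rcases w with _ | ⟨a, w⟩
      · simp [hP0, hψ0, com, trunc]
      · exact com_eq_trunc ψ hi a w
    change F w - P w - star D G F w - star D (t P) G w - coder 𝒱.σ b G w - D.d (G w) = _
    rw [hz, hp]
    abel
  have hU0 : U [] = 0 := by rw [hUZ]; simp [hZ0, hψ0, hG0]
  have mU : ML K U := by
    have : U = fun w => Z w - C.i (ψ w) - D.d (G w) := funext hUZ
    rw [this]
    exact (hZ.sub (mψ.map C.i)).sub (mG.map D.d)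
  have hUh : ∀ w, U w = -C.h (D.d (U w)) := by
    intro w
    have h1 : D.d (U w) = D.d (Z w) := by
      rw [hUZ, map_sub, map_sub, C.d_i, D.d_d, sub_zero, sub_zero]
    rw [h1, hUZ, hψ, hG, map_neg]
    have := C.homotopy (Z w)
    rw [eq_sub_iff_add_eq] at this
    simp only [← this]
    abel
  have hXe : ∀ w : List V,
      (∀ x, x.length < w.length → coder 𝒱.σ b ψ x - com ψ b' x = 0) →
      X w = C.i (coder 𝒱.σ b ψ w - com ψ b' w) := by
    intro w hw
    have h1 := coder_com ψpar T'.b_nil T'.F_ml hw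
    rw [hi] at h1
    rw [← h1]
    have h2 : com ψ (coder 𝒱.σ b' F') w = D.d (P w) + star D P P w := by
      rw [funext T'.eqn, com_add, ← map_com, com_star]
    change coder 𝒱.σ b P w - D.d (P w) - star D P P w = coder 𝒱.σ b P w - _
    rw [h2]
    abel
  have key : ∀ n, ∀ w : List V, w.length = n →
      U w = 0 ∧ coder 𝒱.σ b ψ w - com ψ b' w = 0 := by
    intro n
    induction n using Nat.strong_induction_on with
    | _ n ih =>
    intro w hw
    have hXw : ∀ x : List V, x.length ≤ w.length →
        X x = C.i (coder 𝒱.σ b ψ x - com ψ b' x) := fun x hx =>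
      hXe x fun y hy => (ih _ (by omega) y rfl).2
    have hm := congrFun main w
    have hcU : c U w = 0 := by
      have := coder_congr 𝒱.σ T.b_one mU (ML.zero K) (w := w)
        fun x hx => (ih _ (hw ▸ hx) x rfl).1
      exact this.trans (coder_zero _ _ _)
    have h₂ : star D U F w = 0 :=
      star_eq_zero_left D T.F_nil fun x hx => (ih _ (hw ▸ hx) x rfl).1
    have h₃ : star D P U w = 0 :=
      star_eq_zero_right D hP0 fun x hx => (ih _ (hw ▸ hx) x rfl).1
    have h₄ : star D (t X) G w = 0 := by
      refine star_eq_zero_left D hG0 fun x hx => ?_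
      change X (x.map 𝒱.σ) = 0
      rw [hXw _ (by simp; omega), (ih _ (by simp; omega) _ rfl).2, map_zero]
    simp only [Pi.sub_apply, Pi.add_apply, hcU, h₂, h₃, h₄, hXw w le_rfl] at hm
    have hm' : D.d (U w) = C.i (coder 𝒱.σ b ψ w - com ψ b' w) := by
      have : -D.d (U w) = -C.i (coder 𝒱.σ b ψ w - com ψ b' w) := by simpa [hδ] using hm
      exact neg_injective this
    have hx : coder 𝒱.σ b ψ w - com ψ b' w = 0 := by
      rw [← C.p_i (coder 𝒱.σ b ψ w - com ψ b' w), ← hm', C.p_d]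
    refine ⟨?_, hx⟩
    rw [hUh, hm', hx, map_zero, map_zero, neg_zero]
  refine ⟨ψ, mψ, dψ, hψ0, fun v => ?_, fun w => sub_eq_zero.mp (key _ w rfl).2⟩
  have hz := hfix [v]
  simp only [star_apply, split, coder, T.F_nil, hG0, T.b_one, mG.zero_cons, com] at hz
  change C.p (Z [v]) = _
  rw [hz]
  simp [t, LinearMap.funLeft_apply, hP0, comAux, trunc]

end transfer

end BarWords

open BarWords

section graded

variable {K : Type} [Field K] {V W : GVS K} {M : Type} [AddCommGroup M] [Module K M]

/-- The linear map which restricts to `g e` on the homogeneous elements of degree `e`. -/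
noncomputable def GVS.assemble (V : GVS K) (g : ℤ → V.carrier →ₗ[K] M) : V.carrier →ₗ[K] M :=
  letI := V.decomp
  (DirectSum.toModule K ℤ M fun e => (g e).comp (V.grading e).subtype) ∘ₗ
    (DirectSum.decomposeLinearEquiv V.grading).toLinearMap

theorem GVS.assemble_apply {g : ℤ → V.carrier →ₗ[K] M} {e : ℤ} {v : V.carrier}
    (hv : v ∈ V.grading e) : V.assemble g v = g e v := by
  let := V.decomp
  change DirectSum.toModule K ℤ M _ (DirectSum.decompose V.grading v) = _
  rw [DirectSum.decompose_of_mem _ hv]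
  exact DirectSum.toModule_lof (M := fun e => V.grading e) K e ⟨v, hv⟩

theorem GVS.iSup_grading (V : GVS K) : ⨆ e, V.grading e = ⊤ := by
  let := V.decomp
  exact (DirectSum.Decomposition.isInternal V.grading).submodule_iSup_eq_top

/-- The projection onto the homogeneous component of degree `e`. -/
noncomputable def GVS.proj (V : GVS K) (e : ℤ) : V.carrier →ₗ[K] V.carrier :=
  V.assemble fun f => if f = e then LinearMap.id else 0

theorem GVS.proj_of_mem {e : ℤ} {v : V.carrier} (hv : v ∈ V.grading e) : V.proj e v = v := by
  simp [GVS.proj, V.assemble_apply hv]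

theorem GVS.proj_of_mem_ne {e f : ℤ} {v : V.carrier} (hv : v ∈ V.grading f) (h : f ≠ e) :
    V.proj e v = 0 := by
  simp [GVS.proj, V.assemble_apply hv, h]

theorem GVS.proj_mem (e : ℤ) (v : V.carrier) : V.proj e v ∈ V.grading e := by
  have hv : v ∈ ⨆ e, V.grading e := V.iSup_grading ▸ Submodule.mem_top
  induction hv using Submodule.iSup_induction' with
  | mem f v hv =>
    by_cases h : f = e
    · subst h; rwa [V.proj_of_mem hv]
    · rw [V.proj_of_mem_ne hv h]; exact Submodule.zero_mem _
  | zero => simp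
  | add x y _ _ hx hy => rw [map_add]; exact Submodule.add_mem _ hx hy

/-- The sign involution: multiplication by `(-1) ^ e` in degree `e`. -/
noncomputable def GVS.sgn (V : GVS K) : V.carrier →ₗ[K] V.carrier :=
  V.assemble fun e => (-1 : K) ^ e • LinearMap.id

theorem GVS.sgn_apply {e : ℤ} {v : V.carrier} (hv : v ∈ V.grading e) :
    V.sgn v = (-1 : K) ^ e • v := by
  simp [GVS.sgn, V.assemble_apply hv]

/-- The suspension of a graded vector space. -/
noncomputable def GVS.susp (V : GVS K) : Grad K V.carrier where
  gr e := V.grading (e + 1)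
  σ := -V.sgn
  span := by
    rw [← V.iSup_grading]
    exact (Equiv.addRight (1 : ℤ)).iSup_comp (g := V.grading)
  σ_gr e v hv := by
    rw [LinearMap.neg_apply, V.sgn_apply hv, zpow_add_one₀ (by norm_num)]
    simp

theorem GVS.mem_susp {e : ℤ} {v : V.carrier} : v ∈ V.susp.gr e ↔ v ∈ V.grading (e + 1) := Iff.rfl

theorem GVS.sgn_sgn (v : V.carrier) : V.sgn (V.sgn v) = v := by
  have := V.susp.σ_σ v
  simpa [GVS.susp] using this

theorem GVS.sgn_pow_apply {e : ℤ} {v : V.carrier} (hv : v ∈ V.grading e) (n : ℕ) :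
    (V.sgn ^ n) v = (-1 : K) ^ (n * e) • v := by
  induction n with
  | zero => simp
  | succ n ih =>
    rw [pow_succ', Module.End.mul_apply, ih, map_smul, V.sgn_apply hv, smul_smul,
      ← zpow_add₀ (by norm_num)]
    congr 2; push_cast; ring

end graded

section twisting

variable {K : Type} [Field K] {V W : GVS K} {M : Type} [AddCommGroup M] [Module K M]

/-- Twisting a word by the sign involution; this realizes the signs relating operations on a
graded vector space to operations on its suspension. -/
noncomputable def GVS.twist (V : GVS K) (k : ℕ) : List V.carrier → List V.carrier
  | [] => []
  | a :: w => (V.sgn ^ (w.length + k)) a :: V.twist k w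

theorem GVS.length_twist (k : ℕ) (w : List V.carrier) : (V.twist k w).length = w.length := by
  induction w with
  | nil => rfl
  | cons a w ih => simp [GVS.twist, ih]

theorem GVS.twist_append (k : ℕ) (u v : List V.carrier) :
    V.twist k (u ++ v) = V.twist (k + v.length) u ++ V.twist k v := by
  induction u with
  | nil => rfl
  | cons a u ih =>
    simp only [List.cons_append, GVS.twist, ih, List.length_append]
    congr 3; ring

theorem GVS.sgn_pow_sgn_pow (n : ℕ) (v : V.carrier) : (V.sgn ^ n) ((V.sgn ^ n) v) = v := by
  induction n generalizing v with
  | zero => rfl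
  | succ n ih =>
    conv_lhs => enter [2]; rw [pow_succ', Module.End.mul_apply]
    rw [pow_succ, Module.End.mul_apply, V.sgn_sgn, ih]

theorem GVS.twist_twist (k : ℕ) (w : List V.carrier) : V.twist k (V.twist k w) = w := by
  induction w with
  | nil => rfl
  | cons a w ih => simp only [GVS.twist, ih, V.length_twist, V.sgn_pow_sgn_pow]

theorem ml_twist {F : List V.carrier → M} (hF : ML K F) : ML K fun w => F (V.twist 0 w) := by
  constructor
  · intro u v x y
    simp only [V.twist_append, GVS.twist, map_add, hF.1, List.length_cons]
  · intro u v c x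
    simp only [V.twist_append, GVS.twist, map_smul, hF.2, List.length_cons]

/-- The exponent of the sign produced by `GVS.twist` on a word of given degrees. -/
def twistExp : List ℤ → ℤ
  | [] => 0
  | e :: es => es.length * e + twistExp es

theorem twistExp_append (x y : List ℤ) :
    twistExp (x ++ y) = twistExp x + y.length * x.sum + twistExp y := by
  induction x with
  | nil => simp [twistExp]
  | cons e x ih => simp only [List.cons_append, twistExp, ih, List.length_append, List.sum_cons]; push_cast; ring

theorem GVS.twist_homog {F : List V.carrier → M} (hF : ML K F) {w : List V.carrier} {es : List ℤ}
    (h : List.Forall₂ (fun v e => v ∈ V.grading e) w es) :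
    F (V.twist 0 w) = (-1 : K) ^ twistExp es • F w := by
  induction h generalizing F with
  | nil => simp [GVS.twist, twistExp]
  | @cons a e w es ha hw ih =>
    simp only [GVS.twist, twistExp]
    rw [ih (hF.cons _), V.sgn_pow_apply ha, add_zero]
    have := hF.2 [] w ((-1 : K) ^ ((w.length : ℤ) * e)) a
    simp only [List.nil_append] at this
    rw [this, smul_smul, ← zpow_add₀ (by norm_num), hw.length_eq, add_comm]

theorem GVS.twist_mem {k : ℕ} {w : List V.carrier} {es : List ℤ}
    (h : List.Forall₂ (fun v e => v ∈ V.grading e) w es) :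
    List.Forall₂ (fun v e => v ∈ V.grading e) (V.twist k w) es := by
  induction h with
  | nil => exact List.Forall₂.nil
  | cons ha hw ih =>
    refine List.Forall₂.cons ?_ ih
    rw [V.sgn_pow_apply ha]
    exact Submodule.smul_mem _ _ ha

/-- A family of multilinear maps, viewed as a function on nonempty words. -/
def onWords {V W : Type} [AddCommGroup V] [Module K V] [AddCommGroup W] [Module K W]
    (f : (n : ℕ) → MultilinearMap K (fun _ : Fin n => V) W) (w : List V) : W :=
  if w = [] then 0 else f w.length w.get

theorem onWords_eq {V W : Type} [AddCommGroup V] [Module K V] [AddCommGroup W] [Module K W]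
    (f : (n : ℕ) → MultilinearMap K (fun _ : Fin n => V) W) {w : List V} {n : ℕ} (hn : n ≠ 0)
    (v : Fin n → V) (h : w = List.ofFn v) : onWords f w = f n v := by
  have hl : w.length = n := by rw [h, List.length_ofFn]
  have hv : ∀ j : Fin w.length, w.get j = v (Fin.cast hl j) := by
    subst h; intro j; simp; rfl
  rw [onWords, if_neg (by rintro rfl; exact hn (by simpa using hl.symm))]
  clear h
  subst hl
  congr 1
  funext j
  exact hv j

theorem ml_onWords {V W : Type} [AddCommGroup V] [Module K V] [AddCommGroup W] [Module K W]
    (f : (n : ℕ) → MultilinearMap K (fun _ : Fin n => V) W) : ML K (onWords f) := by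
  have key : ∀ u v : List V, ∃ (n : ℕ) (g : Fin n → V) (i : Fin n),
      ∀ x, onWords f (u ++ x :: v) = f n (Function.update g i x) := by
    intro u v
    refine ⟨(u ++ 0 :: v).length, (u ++ 0 :: v).get, ⟨u.length, by simp⟩, fun x => ?_⟩
    refine onWords_eq f (by simp) _ (List.ext_getElem (by simp [add_assoc]) fun j h₁ h₂ => ?_)
    simp only [List.getElem_ofFn, Function.update_apply, Fin.ext_iff, List.get_eq_getElem]
    rcases lt_trichotomy j u.length with h | h | h
    · rw [if_neg h.ne, List.getElem_append_left h, List.getElem_append_left h]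
    · subst h; simp
    · rw [if_neg h.ne', List.getElem_append_right h.le, List.getElem_append_right h.le,
        List.getElem_cons, List.getElem_cons]
      simp [(Nat.sub_pos_of_lt h).ne']
  constructor
  · intro u v x y
    obtain ⟨n, g, i, h⟩ := key u v
    simp only [h, MultilinearMap.map_update_add]
  · intro u v c x
    obtain ⟨n, g, i, h⟩ := key u v
    simp only [h, MultilinearMap.map_update_smul]

/-- The function on words of the suspension determined by a family of multilinear maps. -/
noncomputable def suspWords
    (f : (n : ℕ) → MultilinearMap K (fun _ : Fin n => V.carrier) W.carrier) (w : List V.carrier) :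
    W.carrier :=
  onWords f (V.twist 0 w)

theorem ml_suspWords (f : (n : ℕ) → MultilinearMap K (fun _ : Fin n => V.carrier) W.carrier) :
    ML K (suspWords f) :=
  ml_twist (ml_onWords f)

theorem suspWords_nil (f : (n : ℕ) → MultilinearMap K (fun _ : Fin n => V.carrier) W.carrier) :
    suspWords f [] = 0 := rfl

theorem onWords_mem {f : (n : ℕ) → MultilinearMap K (fun _ : Fin n => V.carrier) W.carrier} {k : ℤ}
    (hf : ∀ (n : ℕ) (e : Fin n → ℤ) (a : Fin n → V.carrier), (∀ i, a i ∈ V.grading (e i)) →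
      f n a ∈ W.grading ((∑ i, e i) + (k - (n : ℤ)))) {w : List V.carrier} {es : List ℤ}
    (h : List.Forall₂ (fun v e => v ∈ V.grading e) w es) :
    onWords f w ∈ W.grading (es.sum + (k - (w.length : ℤ))) := by
  rw [onWords]
  split_ifs with h0
  · exact Submodule.zero_mem _
  · have := hf w.length (fun i => es[i.1]'(h.length_eq ▸ i.2)) w.get fun i => by
      have := List.forall₂_iff_get.1 h
      exact this.2 i.1 i.2 _
    convert this using 3
    rw [← List.sum_ofFn]
    congr 1
    refine List.ext_getElem (by simp [h.length_eq]) fun j h₁ h₂ => by simp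

theorem hdeg_suspWords {f : (n : ℕ) → MultilinearMap K (fun _ : Fin n => V.carrier) W.carrier}
    {k : ℤ} (hf : ∀ (n : ℕ) (e : Fin n → ℤ) (a : Fin n → V.carrier),
      (∀ i, a i ∈ V.grading (e i)) → f n a ∈ W.grading ((∑ i, e i) + (k + 1 - (n : ℤ)))) :
    HDeg V.susp W.susp k (suspWords f) := by
  intro w es h
  have h' : List.Forall₂ (fun v e => v ∈ V.grading e) w (es.map (· + 1)) := by
    rw [List.forall₂_map_right_iff]; exact h
  have := onWords_mem hf (V.twist_mem (k := 0) h')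
  change onWords f (V.twist 0 w) ∈ W.grading _
  convert this using 2
  rw [V.length_twist, h.length_eq]
  have : (es.map (· + 1)).sum = es.sum + es.length := by
    clear this h' h
    induction es with
    | nil => rfl
    | cons e es ih => simp only [List.map_cons, List.sum_cons, ih, List.length_cons]; push_cast; ring
  rw [this]; ring

theorem List.ofFn_update {α : Type} {n : ℕ} (v : Fin n → α) (i : Fin n) (x : α) :
    List.ofFn (Function.update v i x) =
      (List.ofFn v).take i ++ x :: (List.ofFn v).drop (i + 1) := by
  have h := List.set_eq_take_append_cons_drop (l := List.ofFn v) (i := i) (a := x)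
  rw [if_pos (by simp)] at h
  rw [← h]
  refine List.ext_getElem (by simp) fun j h₁ h₂ => ?_
  simp [List.getElem_set, Function.update_apply, Fin.ext_iff, eq_comm]

/-- The family of multilinear maps determined by a multilinear function on words of the
suspension. -/
noncomputable def ofWords {F : List V.carrier → W.carrier} (hF : ML K F) (n : ℕ) :
    MultilinearMap K (fun _ : Fin n => V.carrier) W.carrier where
  toFun v := F (V.twist 0 (List.ofFn v))
  map_update_add' {inst} v i x y := by
    rw [Subsingleton.elim inst (instDecidableEqFin n)]
    simp only [List.ofFn_update]
    exact (ml_twist hF).1 _ _ _ _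
  map_update_smul' {inst} v i c x := by
    rw [Subsingleton.elim inst (instDecidableEqFin n)]
    simp only [List.ofFn_update]
    exact (ml_twist hF).2 _ _ _ _

theorem onWords_ofWords {F : List V.carrier → W.carrier} (hF : ML K F) (h0 : F [] = 0)
    (w : List V.carrier) : suspWords (ofWords hF) w = F w := by
  rw [suspWords, onWords]
  split_ifs with h
  · have := congrArg List.length h
    rw [V.length_twist] at this
    rw [List.length_eq_zero_iff.1 this, h0]
  · change F (V.twist 0 (List.ofFn (V.twist 0 w).get)) = F w
    rw [List.ofFn_get, V.twist_twist]

theorem ofWords_mem {F : List V.carrier → W.carrier} (hF : ML K F) {k : ℤ}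
    (h : HDeg V.susp W.susp k F) (n : ℕ) (e : Fin n → ℤ) (a : Fin n → V.carrier)
    (ha : ∀ i, a i ∈ V.grading (e i)) :
    ofWords hF n a ∈ W.grading ((∑ i, e i) + (k + 1 - (n : ℤ))) := by
  have h₁ : List.Forall₂ (fun v e => v ∈ V.grading e) (List.ofFn a) (List.ofFn e) :=
    List.forall₂_iff_get.2 ⟨by simp, fun i h₁ h₂ => by simpa using ha _⟩
  have h₂ := V.twist_mem (k := 0) h₁
  have h₃ : List.Forall₂ (fun v e => v ∈ V.susp.gr e) (V.twist 0 (List.ofFn a))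
      ((List.ofFn e).map (· - 1)) := by
    rw [List.forall₂_map_right_iff]
    simpa [GVS.mem_susp] using h₂
  have := h _ _ h₃
  rw [GVS.mem_susp] at this
  change F _ ∈ _
  convert this using 2
  rw [List.map_ofFn, List.sum_ofFn]
  simp only [Function.comp_apply, Finset.sum_sub_distrib, Finset.sum_const, Finset.card_univ,
    Fintype.card_fin, nsmul_eq_mul, mul_one]
  ring

end twisting

section segments

variable {α β M : Type}

/-- The word `a k, …, a (k + n - 1)`. -/
def seg (a : ℕ → α) : ℕ → ℕ → List α
  | _, 0 => []
  | k, n + 1 => a k :: seg a (k + 1) n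

theorem length_seg (a : ℕ → α) (k n : ℕ) : (seg a k n).length = n := by
  induction n generalizing k with
  | zero => rfl
  | succ n ih => simp [seg, ih]

theorem seg_append (a : ℕ → α) (k m n : ℕ) :
    seg a k (m + n) = seg a k m ++ seg a (k + m) n := by
  induction m generalizing k with
  | zero => simp [seg]
  | succ m ih =>
    rw [Nat.succ_add_eq_add_succ, Nat.add_succ]
    simp only [seg, ih, List.cons_append]
    rw [Nat.add_right_comm k 1 m, ← Nat.add_assoc]

theorem seg_eq_ofFn (a : ℕ → α) (k n : ℕ) : seg a k n = List.ofFn fun i : Fin n => a (k + i) := by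
  induction n generalizing k with
  | zero => rfl
  | succ n ih =>
    rw [seg, ih, List.ofFn_succ]
    simp [Nat.add_comm, Nat.add_left_comm]

theorem getElem_seg (a : ℕ → α) (k n i : ℕ) (h : i < (seg a k n).length) :
    (seg a k n)[i] = a (k + i) := by
  simp [seg_eq_ofFn]

theorem forall₂_seg {R : α → β → Prop} {a : ℕ → α} {e : ℕ → β} (h : ∀ i, R (a i) (e i)) (k n : ℕ) :
    List.Forall₂ R (seg a k n) (seg e k n) := by
  induction n generalizing k with
  | zero => exact List.Forall₂.nil
  | succ n ih => exact List.Forall₂.cons (h k) (ih (k + 1))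

theorem sum_seg (e : ℕ → ℤ) (k n : ℕ) :
    (seg e k n).sum = ∑ i ∈ Finset.range n, e (k + i) := by
  rw [seg_eq_ofFn, List.sum_ofFn, Finset.sum_range]

variable [AddCommGroup M]

theorem split_seg (H : List α → List α → M) (a : ℕ → α) (k n : ℕ) :
    split H (seg a k n) =
      ∑ s ∈ Finset.range (n + 1), H (seg a k s) (seg a (k + s) (n - s)) := by
  induction n generalizing H k with
  | zero => simp [seg, split]
  | succ n ih =>
    rw [seg, split, ih, Finset.sum_range_succ' _ (n + 1), add_comm]
    congr 1
    refine Finset.sum_congr rfl fun s _ => ?_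
    rw [Nat.add_sub_add_right, seg, Nat.add_right_comm k 1 s, ← Nat.add_assoc]

theorem sum_Icc_one_succ (f : ℕ → M) (n : ℕ) :
    ∑ s ∈ Finset.Icc 1 (n + 1), f s = ∑ s ∈ Finset.range (n + 1), f (s + 1) := by
  induction n with
  | zero => simp
  | succ n ih => rw [Finset.sum_Icc_succ_top (by omega), ih, Finset.sum_range_succ _ (n + 1)]

theorem coder_seg (σ : α → α) (b : List α → α) (F : List α → M) (a : ℕ → α) (k n : ℕ) :
    coder σ b F (seg a k n) =
      ∑ r ∈ Finset.range n, ∑ s ∈ Finset.Icc 1 (n - r),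
        F ((seg a k r).map σ ++ b (seg a (k + r) s) :: seg a (k + r + s) (n - r - s)) := by
  induction n generalizing F k with
  | zero => rfl
  | succ n ih =>
    rw [seg, coder, ih, Finset.sum_range_succ']
    congr 1
    · refine Finset.sum_congr rfl fun r _ => ?_
      rw [Nat.add_sub_add_right]
      refine Finset.sum_congr rfl fun s _ => ?_
      rw [Nat.add_right_comm k 1 r, ← Nat.add_assoc]
      rfl
    · rw [split_seg, Nat.sub_zero, sum_Icc_one_succ]
      refine Finset.sum_congr rfl fun s _ => ?_
      rw [Nat.add_sub_add_right, seg, Nat.add_right_comm k 1 s, ← Nat.add_assoc]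
      rfl

/-- The word of the values of `ψ` on the consecutive blocks of lengths `bs` of the sequence `a`,
starting at `k`. -/
def blocks {W : Type} (ψ : List α → W) (a : ℕ → α) : ℕ → List ℕ → List W
  | _, [] => []
  | k, b :: bs => ψ (seg a k b) :: blocks ψ a (k + b) bs

theorem length_blocks {W : Type} (ψ : List α → W) (a : ℕ → α) (k : ℕ) (bs : List ℕ) :
    (blocks ψ a k bs).length = bs.length := by
  induction bs generalizing k with
  | nil => rfl
  | cons b bs ih => simp [blocks, ih]

theorem getElem_blocks {W : Type} (ψ : List α → W) (a : ℕ → α) (k : ℕ) (bs : List ℕ) (i : ℕ)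
    (h : i < (blocks ψ a k bs).length) :
    (blocks ψ a k bs)[i] =
      ψ (seg a (k + (bs.take i).sum) (bs[i]'(by rwa [length_blocks] at h))) := by
  induction bs generalizing k i with
  | nil => simp [blocks] at h
  | cons b bs ih =>
    cases i with
    | zero => simp [blocks]
    | succ i => simp [blocks, ih, Nat.add_assoc]

theorem sum_composition_succ (n : ℕ) (g : List ℕ → M) :
    ∑ c : Composition (n + 1), g c.blocks =
      ∑ s : Fin (n + 1), ∑ c : Composition (n - s), g ((s + 1) :: c.blocks) := by
  rw [Finset.sum_sigma']
  symm
  refine Finset.sum_bij (fun x _ => ⟨(x.1 + 1) :: x.2.blocks, ?_, ?_⟩) (by simp) ?_ ?_ (by simp)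
  · intro i hi
    rcases List.mem_cons.1 hi with rfl | hi
    · exact Nat.succ_pos _
    · exact x.2.blocks_pos hi
  · rw [List.sum_cons, x.2.blocks_sum]; omega
  · rintro ⟨s, c⟩ _ ⟨t, d⟩ _ h
    simp only [Composition.mk.injEq, List.cons.injEq, Nat.add_right_cancel_iff] at h
    obtain rfl := Fin.ext h.1
    rw [Composition.ext h.2]
  · rintro ⟨_ | ⟨b, bs⟩, hp, hs⟩ _
    · simp at hs
    · have hb : 0 < b := hp (by simp)
      rw [List.sum_cons] at hs
      refine ⟨⟨⟨b - 1, by omega⟩, ⟨bs, fun h => hp (by simp [h]), by simp; omega⟩⟩, by simp, ?_⟩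
      simp only [Composition.mk.injEq, List.cons.injEq, and_true]
      omega

theorem com_seg {W : Type} (ψ : List α → W) (G : List W → M) (a : ℕ → α) (k n : ℕ) :
    com ψ G (seg a k n) = ∑ c : Composition n, G (blocks ψ a k c.blocks) := by
  induction n using Nat.strong_induction_on generalizing k G with
  | _ n ih =>
    cases n with
    | zero =>
      have : Subsingleton (Composition 0) :=
        Fintype.card_le_one_iff_subsingleton.1 (composition_card 0).le
      rw [Fintype.sum_subsingleton _ (⟨[], by simp, rfl⟩ : Composition 0)]
      rfl
    | succ n =>
      rw [sum_composition_succ n fun bs => G (blocks ψ a k bs), seg, com_cons, split_seg,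
        Finset.sum_range]
      refine Finset.sum_congr rfl fun s _ => ?_
      rw [ih (n - s) (by omega)]
      refine Finset.sum_congr rfl fun c _ => ?_
      rw [blocks, seg, Nat.add_right_comm k 1 s, ← Nat.add_assoc]

end segments

section signs

variable {K : Type} [Field K] {V W : GVS K} {M : Type} [AddCommGroup M] [Module K M]

theorem suspWords_homog (f : (n : ℕ) → MultilinearMap K (fun _ : Fin n => V.carrier) W.carrier)
    {w : List V.carrier} {es : List ℤ} (h : List.Forall₂ (fun v e => v ∈ V.grading e) w es) :
    suspWords f w = (-1 : K) ^ twistExp es • onWords f w :=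
  V.twist_homog (ml_onWords f) h

theorem neg_one_zpow_congr {a b : ℤ} (h : Even (a - b)) : (-1 : K) ^ a = (-1 : K) ^ b := by
  have : a = (a - b) + b := by ring
  rw [this, zpow_add₀ (by norm_num), h.neg_one_zpow, one_mul]

theorem map_susp_homog {F : List V.carrier → M} (hF : ML K F) {x : List V.carrier} {es : List ℤ}
    (h : List.Forall₂ (fun v e => v ∈ V.grading e) x es) (z : List V.carrier) :
    F (x.map V.susp.σ ++ z) = (-1 : K) ^ (es.sum - es.length) • F (x ++ z) := by
  induction h generalizing F with
  | nil => simp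
  | @cons a e w es ha hw ih =>
    have h₁ : V.susp.σ a = (-1 : K) ^ (e - 1) • a :=
      V.susp.σ_gr (e - 1) a (by rw [V.mem_susp]; simpa using ha)
    have h₂ := hF.2 [] (w ++ z) ((-1 : K) ^ (e - 1)) a
    simp only [List.map_cons, List.cons_append, List.nil_append] at h₂ ⊢
    rw [ih (hF.cons _), h₁, h₂, smul_smul, ← zpow_add₀ (by norm_num)]
    congr 2
    simp only [List.sum_cons, List.length_cons]; push_cast; ring

theorem onWords_insert (f : (n : ℕ) → MultilinearMap K (fun _ : Fin n => V.carrier) W.carrier)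
    (m : (n : ℕ) → MultilinearMap K (fun _ : Fin n => V.carrier) V.carrier) (a : ℕ → V.carrier)
    (r s t : ℕ) (hs : s ≠ 0) :
    f (r + 1 + t) (fun j : Fin (r + 1 + t) => if (j : ℕ) < r then a j
        else if (j : ℕ) = r then m s (fun i : Fin s => a (r + (i : ℕ)))
        else a ((j : ℕ) + s - 1)) =
      onWords f (seg a 0 r ++ onWords m (seg a r s) :: seg a (r + s) t) := by
  symm
  refine onWords_eq f (by omega) _ (List.ext_getElem ?_ fun j h₁ h₂ => ?_)
  · simp [length_seg]; omega
  · rw [List.getElem_ofFn]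
    dsimp only
    rcases lt_trichotomy j r with h | h | h
    · rw [if_pos h, List.getElem_append_left (by rwa [length_seg]), getElem_seg, zero_add]
    · rw [if_neg (by omega), if_pos h, List.getElem_append_right (by rw [length_seg]; omega)]
      simp only [length_seg, h, Nat.sub_self, List.getElem_cons_zero]
      exact onWords_eq m hs _ (seg_eq_ofFn a r s)
    · rw [if_neg (by omega), if_neg (by omega),
        List.getElem_append_right (by rw [length_seg]; omega), List.getElem_cons]
      simp only [length_seg]
      rw [dif_neg (by omega), getElem_seg]
      congr 1; omega

/-- The left-hand side of the Stasheff and morphism identities in terms of the coderivation of the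
tensor coalgebra of the suspension. -/
theorem sum_insert_eq_coder
    (f : (n : ℕ) → MultilinearMap K (fun _ : Fin n => V.carrier) W.carrier) (m : AInftyStr K V)
    {e : ℕ → ℤ} {a : ℕ → V.carrier} (ha : ∀ i, a i ∈ V.grading (e i)) (n : ℕ) :
    ∑ r ∈ Finset.range n, ∑ s ∈ Finset.Icc 1 (n - r),
      ((-1 : K) ^ ((r : ℤ) + (s : ℤ) * ((n : ℤ) - (r : ℤ) - (s : ℤ))
          + (s : ℤ) * ∑ i ∈ Finset.range r, e i)) •
        f (r + 1 + (n - r - s)) (fun j : Fin (r + 1 + (n - r - s)) =>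
          if (j : ℕ) < r then a j
          else if (j : ℕ) = r then m.op s (fun i : Fin s => a (r + (i : ℕ)))
          else a ((j : ℕ) + s - 1)) =
      (-1 : K) ^ twistExp (seg e 0 n) •
        coder V.susp.σ (suspWords m.op) (suspWords f) (seg a 0 n) := by
  rw [coder_seg, Finset.smul_sum]
  refine Finset.sum_congr rfl fun r hr => ?_
  rw [Finset.smul_sum]
  refine Finset.sum_congr rfl fun s hs => ?_
  rw [Finset.mem_range] at hr
  rw [Finset.mem_Icc] at hs
  obtain ⟨t, rfl⟩ : ∃ t, n = r + (s + t) := ⟨n - r - s, by omega⟩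
  have ht : r + (s + t) - r - s = t := by omega
  rw [ht, onWords_insert f m.op a r s t (by omega), zero_add]
  have hx := forall₂_seg (R := fun v e => v ∈ V.grading e) ha 0 r
  have hm := forall₂_seg (R := fun v e => v ∈ V.grading e) ha r s
  have hy := forall₂_seg (R := fun v e => v ∈ V.grading e) ha (r + s) t
  have hu := onWords_mem m.op_degree hm
  rw [map_susp_homog (ml_suspWords f) hx, suspWords_homog m.op hm, (ml_suspWords f).2,
    suspWords_homog f (List.rel_append hx (List.Forall₂.cons hu hy)),
    smul_smul, smul_smul, smul_smul, ← zpow_add₀ (by norm_num), ← zpow_add₀ (by norm_num),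
    ← zpow_add₀ (by norm_num)]
  congr 1
  apply neg_one_zpow_congr
  rw [seg_append, seg_append]
  simp only [twistExp_append, twistExp, length_seg, List.length_cons, zero_add,
    List.length_append]
  have := sum_seg e 0 r
  simp only [zero_add] at this
  rw [← this]
  push_cast
  generalize (seg e 0 r).sum = X
  generalize (seg e r s).sum = Y
  generalize twistExp (seg e 0 r) = p
  generalize twistExp (seg e r s) = q
  generalize twistExp (seg e (r + s) t) = u
  rw [even_iff_two_dvd]
  refine ⟨s * t - t * X - t * Y - X - t - p - q - u + r, by ring⟩

/-- The total degrees of the consecutive blocks of lengths `bs`, starting at `k`, after applying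
operations of degree `1 - n`. -/
def blockDegrees (e : ℕ → ℤ) : ℕ → List ℕ → List ℤ
  | _, [] => []
  | k, b :: bs => ((seg e k b).sum + (1 - (b : ℤ))) :: blockDegrees e (k + b) bs

theorem length_blockDegrees (e : ℕ → ℤ) (k : ℕ) (bs : List ℕ) :
    (blockDegrees e k bs).length = bs.length := by
  induction bs generalizing k with
  | nil => rfl
  | cons b bs ih => simp [blockDegrees, ih]

/-- The exponent of the sign of the summand of an `A∞`-morphism equation. -/
def blockExp (e : ℕ → ℤ) : ℕ → List ℕ → ℤ
  | _, [] => 0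
  | k, b :: bs => bs.length * ((b : ℤ) - 1) + (1 - (b : ℤ)) * (seg e 0 k).sum +
      blockExp e (k + b) bs

/-- The sum of the twisting exponents of the blocks. -/
def blockTwist (e : ℕ → ℤ) : ℕ → List ℕ → ℤ
  | _, [] => 0
  | k, b :: bs => twistExp (seg e k b) + blockTwist e (k + b) bs

theorem blockExp_parity (e : ℕ → ℤ) (k : ℕ) (bs : List ℕ) :
    Even (blockTwist e k bs + twistExp (blockDegrees e k bs) + twistExp (seg e k bs.sum) +
      blockExp e k bs + (seg e 0 k).sum * (bs.length - bs.sum)) := by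
  induction bs generalizing k with
  | nil => simp [blockTwist, blockDegrees, twistExp, seg, blockExp]
  | cons b bs ih =>
    obtain ⟨c, hc⟩ := ih (k + b)
    simp only [blockTwist, blockDegrees, twistExp, blockExp, List.sum_cons, List.length_cons,
      length_blockDegrees]
    rw [seg_append, twistExp_append, length_seg]
    rw [seg_append, List.sum_append, zero_add] at hc
    simp only [Nat.cast_add, Nat.cast_one]
    refine ⟨c + twistExp (seg e k b) + (1 - b) * (seg e 0 k).sum + bs.sum * (seg e k b).sum, ?_⟩
    linear_combination hc

theorem blockExp_eq (e : ℕ → ℤ) (k : ℕ) (bs : List ℕ) :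
    blockExp e k bs = (∑ j : Fin bs.length, ((bs.length : ℤ) - 1 - (j : ℤ)) * ((bs[j] : ℤ) - 1)) +
      ∑ j : Fin bs.length,
        (1 - (bs[j] : ℤ)) * ∑ i ∈ Finset.range (k + (bs.take j).sum), e i := by
  induction bs generalizing k with
  | nil => simp [blockExp]
  | cons b bs ih =>
    rw [blockExp, ih, sum_seg]
    simp only [List.length_cons, Fin.sum_univ_succ]
    simp only [Fin.getElem_fin, Fin.val_zero, Fin.val_succ, List.getElem_cons_zero,
      List.getElem_cons_succ, List.take_zero, List.take_succ_cons, List.sum_nil, List.sum_cons,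
      Nat.cast_add, Nat.cast_one, zero_add, add_zero, Nat.cast_zero, ← add_assoc]
    have : ∀ j : Fin bs.length, ((bs.length : ℤ) + 1 - 1 - (j + 1)) = bs.length - 1 - j :=
      fun j => by ring
    simp only [this]
    ring

theorem blocks_homog {φ : AInftyHomData K V W} {G : List W.carrier → M} (hG : ML K G)
    {e : ℕ → ℤ} {a : ℕ → V.carrier} (ha : ∀ i, a i ∈ V.grading (e i)) (k : ℕ) (bs : List ℕ) :
    G (blocks (suspWords φ.f) a k bs) =
      (-1 : K) ^ blockTwist e k bs • G (blocks (onWords φ.f) a k bs) := by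
  induction bs generalizing k G with
  | nil => simp [blocks, blockTwist]
  | cons b bs ih =>
    have h := hG.2 [] (blocks (onWords φ.f) a (k + b) bs) ((-1 : K) ^ twistExp (seg e k b))
      (onWords φ.f (seg a k b))
    rw [blocks, ih (hG.cons _), 
      suspWords_homog φ.f (forall₂_seg (R := fun v e => v ∈ V.grading e) ha k b)]
    simp only [List.nil_append] at h
    rw [h, smul_smul, ← zpow_add₀ (by norm_num), blockTwist, add_comm]
    rfl

theorem blocks_mem (φ : AInftyHomData K V W)
    {e : ℕ → ℤ} {a : ℕ → V.carrier} (ha : ∀ i, a i ∈ V.grading (e i)) (k : ℕ) (bs : List ℕ) :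
    List.Forall₂ (fun v e => v ∈ W.grading e) (blocks (onWords φ.f) a k bs)
      (blockDegrees e k bs) := by
  induction bs generalizing k with
  | nil => exact List.Forall₂.nil
  | cons b bs ih =>
    refine List.Forall₂.cons ?_ (ih _)
    have := onWords_mem φ.f_degree (forall₂_seg (R := fun v e => v ∈ V.grading e) ha k b)
    rwa [length_seg] at this

/-- The right-hand side of the morphism identities in terms of the coalgebra morphism of tensor
coalgebras of the suspensions. -/
theorem sum_blocks_eq_com (φ : AInftyHomData K V W) (m : AInftyStr K W)
    {e : ℕ → ℤ} {a : ℕ → V.carrier} (ha : ∀ i, a i ∈ V.grading (e i)) {n : ℕ} (hn : n ≠ 0) :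
    ∑ c : Composition n,
      ((-1 : K) ^ ((∑ j : Fin c.length,
            ((c.length : ℤ) - 1 - (j : ℤ)) * ((c.blocksFun j : ℤ) - 1))
          + ∑ j : Fin c.length,
            (1 - (c.blocksFun j : ℤ)) * ∑ i ∈ Finset.range (c.sizeUpTo (j : ℕ)), e i)) •
        m.op c.length (fun j : Fin c.length =>
          φ.f (c.blocksFun j) (fun i : Fin (c.blocksFun j) =>
            a (c.sizeUpTo (j : ℕ) + (i : ℕ)))) =
      (-1 : K) ^ twistExp (seg e 0 n) • com (suspWords φ.f) (suspWords m.op) (seg a 0 n) := by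
  rw [com_seg, Finset.smul_sum]
  refine Finset.sum_congr rfl fun c _ => ?_
  rw [blocks_homog (ml_suspWords m.op) ha, suspWords_homog m.op (blocks_mem φ ha 0 c.blocks),
    smul_smul, smul_smul, ← zpow_add₀ (by norm_num), ← zpow_add₀ (by norm_num)]
  have h := blockExp_eq e 0 c.blocks
  have hp := blockExp_parity e 0 c.blocks
  have hw : onWords m.op (blocks (onWords φ.f) a 0 c.blocks) =
      m.op c.length (fun j : Fin c.length =>
          φ.f (c.blocksFun j) (fun i : Fin (c.blocksFun j) =>
            a (c.sizeUpTo (j : ℕ) + (i : ℕ)))) := by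
    refine onWords_eq m.op ?_ _ (List.ext_getElem ?_ fun j h₁ h₂ => ?_)
    · have := c.length_pos_of_pos (Nat.pos_of_ne_zero hn); omega
    · simp [length_blocks]
    · rw [getElem_blocks, List.getElem_ofFn]
      refine onWords_eq φ.f ?_ _ ?_
      · have := c.one_le_blocksFun ⟨j, by simpa using h₂⟩; exact Nat.one_le_iff_ne_zero.1 this
      · rw [seg_eq_ofFn, zero_add]; rfl
  rw [hw]
  congr 1
  refine neg_one_zpow_congr ?_
  simp only [zero_add] at h
  change Even ((∑ j : Fin c.blocks.length,
            ((c.blocks.length : ℤ) - 1 - (j : ℤ)) * ((c.blocks[j] : ℤ) - 1))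
          + ∑ j : Fin c.blocks.length,
            (1 - (c.blocks[j] : ℤ)) * ∑ i ∈ Finset.range (c.blocks.take j).sum, e i - _)
  rw [← h]
  rw [c.blocks_sum] at hp
  obtain ⟨x, hx⟩ := hp
  simp only [seg, List.sum_nil, zero_mul, add_zero] at hx
  exact ⟨blockExp e 0 c.blocks - x, by linear_combination -hx⟩

end signs

section translation

variable {K : Type} [Field K] {V W : GVS K} {M : Type} [AddCommGroup M] [Module K M]

theorem ML.eq_zero_of_homog {F : List V.carrier → M} (hF : ML K F)
    (h : ∀ w es, List.Forall₂ (fun v e => v ∈ V.grading e) w es → F w = 0) (w : List V.carrier) :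
    F w = 0 := by
  induction w generalizing F with
  | nil => exact h [] [] List.Forall₂.nil
  | cons a w ih =>
    have ha : a ∈ ⨆ e, V.grading e := V.iSup_grading ▸ Submodule.mem_top
    change hF.head w a = 0
    induction ha using Submodule.iSup_induction' with
    | mem e a ha => exact ih (hF.cons a) fun w es hw => h _ _ (List.Forall₂.cons ha hw)
    | zero => exact map_zero _
    | add x y _ _ hx hy => rw [map_add, hx, hy, add_zero]

theorem ML.ext_homog {F G : List V.carrier → M} (hF : ML K F) (hG : ML K G) (h0 : F [] = G [])
    (h : ∀ n, n ≠ 0 → ∀ (e : ℕ → ℤ) (a : ℕ → V.carrier), (∀ i, a i ∈ V.grading (e i)) →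
      F (seg a 0 n) = G (seg a 0 n)) (w : List V.carrier) : F w = G w := by
  refine sub_eq_zero.1 (ML.eq_zero_of_homog (hF.sub hG) (fun w es hw => ?_) w)
  rw [sub_eq_zero]
  rcases eq_or_ne w [] with rfl | hne
  · exact h0
  · have hs : w = seg (fun i => w.getD i 0) 0 w.length := by
      refine List.ext_getElem (by rw [length_seg]) fun j h₁ h₂ => ?_
      rw [getElem_seg]; simp [h₁]
    rw [hs]
    refine h w.length (by simpa using hne) (fun i => es.getD i 0) _ fun i => ?_
    rcases lt_or_ge i w.length with hi | hi
    · have := (List.forall₂_iff_get.1 hw).2 i hi (hw.length_eq ▸ hi)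
      have hi' := hw.length_eq ▸ hi
      simpa [hi, hi'] using this
    · rw [List.getD_eq_default _ _ hi]; exact Submodule.zero_mem _

theorem stasheff_iff (m : AInftyStr K V) :
    (∀ n, 1 ≤ n → m.Stasheff n) ↔
      ∀ w, coder V.susp.σ (suspWords m.op) (suspWords m.op) w = 0 := by
  constructor
  · intro h
    refine ML.ext_homog (ML.coder (ml_suspWords m.op) (ml_suspWords m.op) V.susp.σ) (ML.zero K) rfl
      fun n hn e a ha => ?_
    have := (sum_insert_eq_coder m.op m ha n).symm.trans
      (h n (Nat.one_le_iff_ne_zero.2 hn) e a ha)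
    exact (smul_eq_zero.1 this).resolve_left (zpow_ne_zero _ (by norm_num))
  · intro h n _ e a ha
    refine (sum_insert_eq_coder m.op m ha n).trans ?_
    rw [h, smul_zero]

theorem isAInftyMorphism_iff (φ : AInftyHomData K V W) (m : AInftyStr K V) (m' : AInftyStr K W) :
    IsAInftyMorphism φ m m' ↔
      ∀ w, coder V.susp.σ (suspWords m.op) (suspWords φ.f) w =
        com (suspWords φ.f) (suspWords m'.op) w := by
  constructor
  · intro h
    refine ML.ext_homog (ML.coder (ml_suspWords φ.f) (ml_suspWords m.op) V.susp.σ)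
      (ML.com (ml_suspWords m'.op) (ml_suspWords φ.f)) rfl fun n hn e a ha => ?_
    have := ((sum_insert_eq_coder φ.f m ha n).symm.trans
      (h n (Nat.one_le_iff_ne_zero.2 hn) e a ha)).trans (sum_blocks_eq_com φ m' ha hn)
    exact smul_right_injective _ (zpow_ne_zero _ (by norm_num)) this
  · intro h n hn e a ha
    refine (sum_insert_eq_coder φ.f m ha n).trans ?_
    rw [h]
    exact (sum_blocks_eq_com φ m' ha (Nat.one_le_iff_ne_zero.1 hn)).symm

theorem suspWords_singleton (f : (n : ℕ) → MultilinearMap K (fun _ : Fin n => V.carrier) W.carrier)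
    (v : V.carrier) : suspWords f [v] = f 1 fun _ => v := by
  refine onWords_eq f one_ne_zero _ ?_
  simp [GVS.twist]

theorem suspWords_pair (f : (n : ℕ) → MultilinearMap K (fun _ : Fin n => V.carrier) W.carrier)
    (v v' : V.carrier) : suspWords f [v, v'] = f 2 ![V.sgn v, v'] := by
  refine onWords_eq f two_ne_zero _ ?_
  simp [GVS.twist]

end translation

section dg

variable {K : Type} [Field K]

theorem hdeg_op {V : GVS K} (m : AInftyStr K V) : HDeg V.susp V.susp 1 (suspWords m.op) :=
  hdeg_suspWords m.op_degree

theorem hdeg_hom {V W : GVS K} (φ : AInftyHomData K V W) :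
    HDeg V.susp W.susp 0 (suspWords φ.f) :=
  hdeg_suspWords φ.f_degree

theorem DGAlg.suspWords_op (A : DGAlg K) (x y z : A.V.carrier) (w : List A.V.carrier) :
    suspWords A.str.op (x :: y :: z :: w) = 0 := by
  rw [suspWords, onWords, A.higher _ (by simp [A.V.length_twist])]
  simp

theorem DGAlg.coder_op (A : DGAlg K) (w : List A.V.carrier) :
    coder A.V.susp.σ (suspWords A.str.op) (suspWords A.str.op) w = 0 :=
  (stasheff_iff A.str).1 A.stasheff w

/-- The operations of a dg-algebra on its suspension. -/
noncomputable def DGAlg.ops (A : DGAlg K) : DGOps A.V.susp where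
  d := (ml_suspWords A.str.op).head []
  μ := LinearMap.mk₂ K (fun x y => suspWords A.str.op [x, y])
    (fun x x' y => (ml_suspWords A.str.op).1 [] [y] x x')
    (fun c x y => (ml_suspWords A.str.op).2 [] [y] c x)
    (fun x y y' => (ml_suspWords A.str.op).1 [x] [] y y')
    (fun c x y => (ml_suspWords A.str.op).2 [x] [] c y)
  d_d x := by simpa [coder, split] using A.coder_op [x]
  d_μ x y := by
    have := A.coder_op [x, y]
    simp only [coder, split, zero_add] at this
    rw [← add_assoc, add_comm, ← eq_neg_iff_add_eq_zero] at this
    simp only [LinearMap.mk₂_apply, ML.head_apply]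
    rw [this]
    abel
  μ_μ x y z := by
    have := A.coder_op [x, y, z]
    simp only [coder, split, zero_add, A.suspWords_op] at this
    rw [(ml_suspWords A.str.op).zero_cons, add_zero, add_comm, ← eq_neg_iff_add_eq_zero] at this
    simpa only [LinearMap.mk₂_apply] using this
  d_gr e x hx := by
    have := hdeg_op A.str [x] [e] (by simpa using hx)
    simpa using this
  μ_gr e f x hx y hy := by
    have := hdeg_op A.str [x, y] [e, f] (by simpa using ⟨hx, hy⟩)
    simpa using this

theorem DGAlg.ops_d (A : DGAlg K) (x : A.V.carrier) : A.ops.d x = A.d x :=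
  suspWords_singleton A.str.op x

theorem DGAlg.ops_μ (A : DGAlg K) (x y : A.V.carrier) : A.ops.μ x y = A.mul (A.V.sgn x) y :=
  suspWords_pair A.str.op x y

theorem DGAlg.com_op (A : DGAlg K) {V : GVS K} {F : List V.carrier → A.V.carrier} (h0 : F [] = 0)
    (w : List V.carrier) : com F (suspWords A.str.op) w = A.ops.d (F w) + star A.ops F F w := by
  cases w with
  | nil => simp [com, h0, star_nil A.ops h0, suspWords_nil]
  | cons a w =>
    have h : ∀ u y, com F (fun z => suspWords A.str.op (u :: z)) y =
        (if y = [] then A.ops.d u else 0) + A.ops.μ u (F y) := by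
      rintro u (_ | ⟨b, y⟩)
      · rw [if_pos rfl, h0, map_zero, add_zero]; rfl
      · rw [if_neg (List.cons_ne_nil _ _), zero_add, com_cons]
        refine (split_eq_last fun x y' e hy => ?_).trans ?_
        · cases y' with
          | nil => exact absurd rfl hy
          | cons c y' =>
            rw [com_cons]
            exact split_eq_zero fun _ _ _ => by
              rw [show (fun z => _) = fun _ => (0 : A.V.carrier) from
                funext fun z => A.suspWords_op _ _ _ z]
              exact com_zero F _
        · rfl
    rw [com_cons, split_congr fun x y _ => h _ y, split_add, star_apply, split, h0, map_zero,
      LinearMap.zero_apply, zero_add]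
    congr 1
    refine (split_eq_last fun x y e hy => if_neg hy).trans (if_pos rfl)

/-- An `A∞`-morphism from a minimal `A∞`-algebra to a dg-algebra, on suspensions. -/
theorem AInftyHomData.twist {V : GVS K} {A : DGAlg K} {m : AInftyStr K V}
    (hm : ∀ n, 1 ≤ n → m.Stasheff n) (h1 : m.op 1 = 0) {φ : AInftyHomData K V A.V}
    (hφ : IsAInftyMorphism φ m A.str) :
    Twist V.susp A.ops (suspWords φ.f) (suspWords m.op) where
  F_ml := ml_suspWords _
  b_ml := ml_suspWords _
  F_deg := hdeg_hom φ
  b_deg := hdeg_op m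
  F_nil := rfl
  b_nil := rfl
  b_one v := by rw [suspWords_singleton, h1]; rfl
  b_b := (stasheff_iff m).1 hm
  eqn w := by rw [(isAInftyMorphism_iff φ m A.str).1 hφ, A.com_op (suspWords_nil _)]

end dg

section contraction

variable {K : Type} [Field K] {V : GVS K}

theorem GVS.hom_ext (V : GVS K) {M : Type} [AddCommGroup M] [Module K M] {f g : V.carrier →ₗ[K] M}
    (h : ∀ e, ∀ v ∈ V.grading e, f v = g v) (v : V.carrier) : f v = g v :=
  V.susp.ext_linear (fun _ v hv => h _ v hv) v

theorem DGAlg.d_mem (A : DGAlg K) {e : ℤ} {x : A.V.carrier} (hx : x ∈ A.V.grading e) :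
    A.ops.d x ∈ A.V.grading (e + 1) := by
  have := A.ops.d_gr (e - 1) x (by rw [GVS.mem_susp, sub_add_cancel]; exact hx)
  rwa [GVS.mem_susp, sub_add_cancel] at this

theorem DGAlg.d_proj (A : DGAlg K) (e : ℤ) (x : A.V.carrier) :
    A.ops.d (A.V.proj e x) = A.V.proj (e + 1) (A.ops.d x) := by
  refine A.V.hom_ext (f := A.ops.d ∘ₗ A.V.proj e) (g := A.V.proj (e + 1) ∘ₗ A.ops.d)
    (fun f v hv => ?_) x
  simp only [LinearMap.comp_apply]
  by_cases h : f = e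
  · subst h; rw [GVS.proj_of_mem hv, GVS.proj_of_mem (A.d_mem hv)]
  · rw [GVS.proj_of_mem_ne hv h, GVS.proj_of_mem_ne (A.d_mem hv) (by simpa using h), map_zero]

theorem exists_pseudoinverse {M : Type} [AddCommGroup M] [Module K M] (d : M →ₗ[K] M) :
    ∃ g : M →ₗ[K] M, ∀ x, d (g (d x)) = d x := by
  obtain ⟨r, hr⟩ := d.rangeRestrict.exists_rightInverse_of_surjective d.range_rangeRestrict
  obtain ⟨l, hl⟩ := (LinearMap.range d).subtype.exists_leftInverse_of_injective
    (Submodule.ker_subtype _)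
  refine ⟨r ∘ₗ l, fun x => ?_⟩
  have h₁ : l (d x) = d.rangeRestrict x := LinearMap.congr_fun hl (d.rangeRestrict x)
  have h₂ : d.rangeRestrict (r (d.rangeRestrict x)) = d.rangeRestrict x :=
    LinearMap.congr_fun hr (d.rangeRestrict x)
  rw [LinearMap.comp_apply, h₁]
  exact congrArg Subtype.val h₂

theorem exists_retraction {M N : Type} [AddCommGroup M] [Module K M] [AddCommGroup N] [Module K N]
    (d : M →ₗ[K] M) (i : N →ₗ[K] M) (h : ∀ v, (∃ c, i v = d c) → v = 0) :
    ∃ p : M →ₗ[K] N, (∀ v, p (i v) = v) ∧ ∀ x, p (d x) = 0 := by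
  have hk : LinearMap.ker ((LinearMap.range d).mkQ ∘ₗ i) = ⊥ := by
    refine LinearMap.ker_eq_bot'.2 fun v hv => h v ?_
    obtain ⟨c, hc⟩ := (Submodule.Quotient.mk_eq_zero _).1 hv
    exact ⟨c, hc.symm⟩
  obtain ⟨l, hl⟩ := LinearMap.exists_leftInverse_of_injective _ hk
  refine ⟨l ∘ₗ (LinearMap.range d).mkQ, fun v => LinearMap.congr_fun hl v, fun x => ?_⟩
  have : (LinearMap.range d).mkQ (d x) = 0 := (Submodule.Quotient.mk_eq_zero _).2 ⟨x, rfl⟩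
  rw [LinearMap.comp_apply, this, map_zero]

/-- A graded linear quasi-isomorphism onto a dg-algebra from a graded vector space with zero
differential extends to a contraction. -/
theorem DGAlg.exists_contraction (A : DGAlg K) (i : V.carrier →ₗ[K] A.V.carrier)
    (i_gr : ∀ e, ∀ v ∈ V.grading e, i v ∈ A.V.grading e) (d_i : ∀ v, A.ops.d (i v) = 0)
    (inj : ∀ v, (∃ c, i v = A.ops.d c) → v = 0)
    (surj : ∀ y, A.ops.d y = 0 → ∃ v c, y - i v = A.ops.d c) :
    ∃ C : Contraction V.susp A.ops, C.i = i := by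
  obtain ⟨g₀, hg₀⟩ := exists_pseudoinverse A.ops.d
  obtain ⟨p₀, hp₀, hp₀'⟩ := exists_retraction A.ops.d i inj
  let g := A.V.assemble fun e => A.V.proj (e - 1) ∘ₗ g₀
  let p₁ := A.V.assemble fun e => V.proj e ∘ₗ p₀
  have g_gr : ∀ e, ∀ x ∈ A.V.grading e, g x ∈ A.V.grading (e - 1) := fun e x hx => by
    simp only [g, A.V.assemble_apply hx]; exact A.V.proj_mem _ _
  have p₁_gr : ∀ e, ∀ x ∈ A.V.grading e, p₁ x ∈ V.grading e := fun e x hx => by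
    simp only [p₁, A.V.assemble_apply hx]; exact V.proj_mem _ _
  have hg : ∀ x, A.ops.d (g (A.ops.d x)) = A.ops.d x := by
    refine A.V.hom_ext (f := A.ops.d ∘ₗ g ∘ₗ A.ops.d) (g := A.ops.d) fun e x hx => ?_
    simp only [g, LinearMap.comp_apply, A.V.assemble_apply (A.d_mem hx)]
    rw [add_sub_cancel_right, A.d_proj, hg₀, A.V.proj_of_mem (A.d_mem hx)]
  have hp₁ : ∀ v, p₁ (i v) = v := by
    refine V.hom_ext (f := p₁ ∘ₗ i) (g := LinearMap.id) fun e v hv => ?_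
    simp only [p₁, LinearMap.comp_apply, A.V.assemble_apply (i_gr e v hv), hp₀,
      V.proj_of_mem hv, LinearMap.id_apply]
  have hp₁' : ∀ x, p₁ (A.ops.d x) = 0 := by
    refine A.V.hom_ext (f := p₁ ∘ₗ A.ops.d) (g := 0) fun e x hx => ?_
    simp only [p₁, LinearMap.comp_apply, A.V.assemble_apply (A.d_mem hx), hp₀', map_zero,
      LinearMap.zero_apply]
  let q : A.V.carrier →ₗ[K] A.V.carrier := LinearMap.id - g ∘ₗ A.ops.d
  let p := p₁ ∘ₗ q
  let h := -(g ∘ₗ (LinearMap.id - i ∘ₗ p) ∘ₗ q)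
  have hq : ∀ x, q x = x - g (A.ops.d x) := fun _ => rfl
  have hp : ∀ x, p x = p₁ (q x) := fun _ => rfl
  have hh : ∀ x, h x = -g (q x - i (p (q x))) := fun _ => rfl
  have q_gr : ∀ e, ∀ x ∈ A.V.grading e, q x ∈ A.V.grading e := fun e x hx => by
    have := g_gr _ _ (A.d_mem hx)
    rw [add_sub_cancel_right] at this
    exact Submodule.sub_mem _ hx this
  have p_gr : ∀ e, ∀ x ∈ A.V.grading e, p x ∈ V.grading e := fun e x hx =>
    p₁_gr _ _ (q_gr _ _ hx)
  have p_i : ∀ v, p (i v) = v := fun v => by rw [hp, hq, d_i, map_zero, sub_zero, hp₁]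
  have p_d : ∀ x, p (A.ops.d x) = 0 := fun x => by
    rw [hp, hq, A.ops.d_d, map_zero, sub_zero, hp₁']
  have p_gd : ∀ x, p (g (A.ops.d x)) = 0 := fun x => by rw [hp, hq, hg, sub_self, map_zero]
  have d_g : ∀ y, A.ops.d y = 0 → p y = 0 → A.ops.d (g y) = y := fun y hy hpy => by
    obtain ⟨v, c, hc⟩ := surj y hy
    have hv : v = 0 := by
      have := congrArg p hc
      rwa [map_sub, hpy, p_i, p_d, zero_sub, neg_eq_zero] at this
    rw [hv, map_zero, sub_zero] at hc
    rw [hc, hg]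
  refine ⟨⟨i, p, h, fun e x hx => i_gr _ _ hx, fun e x hx => p_gr _ _ hx, fun e x hx => ?_, d_i,
    p_d, p_i, fun x => ?_⟩, rfl⟩
  · rw [hh]
    have := g_gr _ _ (Submodule.sub_mem _ (q_gr _ _ hx) (i_gr _ _ (p_gr _ _ (q_gr _ _ hx))))
    have e' : e + -1 + 1 = e + 1 - 1 := by ring
    rw [GVS.mem_susp, e']
    exact Submodule.neg_mem _ this
  · have h₁ : A.ops.d (q x) = 0 := by rw [hq, map_sub, hg, sub_self]
    have h₂ : q (A.ops.d x) = A.ops.d x := by rw [hq, A.ops.d_d, map_zero, sub_zero]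
    have h₃ : p (q x) = p x := by rw [hq, map_sub, p_gd, sub_zero]
    rw [hh, hh, h₂, p_d, map_zero, sub_zero, map_neg,
      d_g _ (by rw [map_sub, h₁, d_i, sub_zero]) (by rw [map_sub, p_i, sub_self]), h₃, hq]
    abel

end contraction

section main

variable {K : Type} [Field K]

theorem AInftyStr.d_eq_zero {V : GVS K} {m : AInftyStr K V} (h : m.op 1 = 0) (x : V.carrier) :
    m.d x = 0 := by
  rw [AInftyStr.d, h]; rfl

theorem BarWords.Twist.d_letter {V : GVS K} {A : DGAlg K} {F : List V.carrier → A.V.carrier}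
    {b : List V.carrier → V.carrier} (T : Twist V.susp A.ops F b) (v : V.carrier) :
    A.ops.d (F [v]) = 0 := by
  have := T.eqn [v]
  simpa [coder, split, star_apply, T.b_one, T.F_nil, T.F_ml.zero_cons] using this.symm

/-- The `A∞`-structure determined by operations on words of the suspension. -/
noncomputable def AInftyStr.ofWords {V : GVS K} {b : List V.carrier → V.carrier} (hb : ML K b)
    (hd : HDeg V.susp V.susp 1 b) : AInftyStr K V where
  op := _root_.ofWords hb
  op_degree := ofWords_mem hb hd

/-- The morphism data determined by a function on words of the suspension. -/
noncomputable def AInftyHomData.ofWords {V W : GVS K} {F : List V.carrier → W.carrier}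
    (hF : ML K F) (hd : HDeg V.susp W.susp 0 F) : AInftyHomData K V W where
  f := _root_.ofWords hF
  f_degree := ofWords_mem hF hd

theorem AInftyStr.suspWords_ofWords {V : GVS K} {b : List V.carrier → V.carrier} (hb : ML K b)
    (hd : HDeg V.susp V.susp 1 b) (h0 : b [] = 0) : suspWords (AInftyStr.ofWords hb hd).op = b :=
  funext (onWords_ofWords hb h0)

theorem AInftyHomData.suspWords_ofWords {V W : GVS K} {F : List V.carrier → W.carrier}
    (hF : ML K F) (hd : HDeg V.susp W.susp 0 F) (h0 : F [] = 0) :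
    suspWords (AInftyHomData.ofWords hF hd).f = F :=
  funext (onWords_ofWords hF h0)

theorem AInftyHomData.suspWords_singleton {V W : GVS K} (φ : AInftyHomData K V W) (x : V.carrier) :
    suspWords φ.f [x] = φ.f1 x :=
  _root_.suspWords_singleton φ.f x

variable {A : DGAlg K} (P : CohomPres K A)

/-- Taking cohomology classes, as a linear map on cocycles. -/
noncomputable def CohomPres.clsL : LinearMap.ker A.ops.d →ₗ[K] P.H.V.carrier where
  toFun x := P.cls x
  map_add' x y := P.cls_add x y ((A.ops_d _).symm.trans x.2) ((A.ops_d _).symm.trans y.2)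
  map_smul' c x := P.cls_smul c x ((A.ops_d _).symm.trans x.2)

/-- Cohomology classes can be represented linearly by cocycles, respecting degrees. -/
theorem CohomPres.exists_section :
    ∃ i : P.H.V.carrier →ₗ[K] A.V.carrier,
      (∀ e, ∀ v ∈ P.H.V.grading e, i v ∈ A.V.grading e) ∧ (∀ v, A.ops.d (i v) = 0) ∧
      ∀ v, P.cls (i v) = v := by
  have hs : ∀ e, ∃ s : P.H.V.carrier →ₗ[K] A.V.carrier,
      ∀ v ∈ P.H.V.grading e, s v ∈ A.V.grading e ∧ A.ops.d (s v) = 0 ∧ P.cls (s v) = v := by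
    intro e
    let Z : Submodule K A.V.carrier := LinearMap.ker A.ops.d ⊓ A.V.grading e
    have hZ : ∀ x : Z, A.d x = 0 := fun x => (A.ops_d _).symm.trans x.2.1
    let c : Z →ₗ[K] P.H.V.grading e :=
      { toFun := fun x => ⟨P.cls x, P.cls_grading e x (hZ x) x.2.2⟩
        map_add' := fun x y => Subtype.ext (P.cls_add x y (hZ x) (hZ y))
        map_smul' := fun k x => Subtype.ext (P.cls_smul k x (hZ x)) }
    have hc : LinearMap.range c = ⊤ := by
      refine LinearMap.range_eq_top.2 fun ⟨v, hv⟩ => ?_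
      obtain ⟨x, hx, hx', h⟩ := P.cls_grading_surj e v hv
      exact ⟨⟨x, (A.ops_d x).trans hx, hx'⟩, Subtype.ext h⟩
    obtain ⟨r, hr⟩ := c.exists_rightInverse_of_surjective hc
    refine ⟨Z.subtype ∘ₗ r ∘ₗ (P.H.V.proj e).codRestrict _ (P.H.V.proj_mem e), fun v hv => ?_⟩
    have : (P.H.V.proj e).codRestrict _ (P.H.V.proj_mem e) v = ⟨v, hv⟩ :=
      Subtype.ext (P.H.V.proj_of_mem hv)
    simp only [LinearMap.comp_apply, this]
    exact ⟨(r ⟨v, hv⟩).2.2, (r ⟨v, hv⟩).2.1, congrArg Subtype.val (LinearMap.congr_fun hr ⟨v, hv⟩)⟩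
  choose s hs using hs
  let i := P.H.V.assemble s
  have hi : ∀ e, ∀ v ∈ P.H.V.grading e, i v = s e v := fun e v hv => P.H.V.assemble_apply hv
  have d_i : ∀ v, A.ops.d (i v) = 0 := P.H.V.hom_ext (f := A.ops.d ∘ₗ i) (g := 0) fun e v hv => by
    rw [LinearMap.comp_apply, hi e v hv, (hs e v hv).2.1, LinearMap.zero_apply]
  refine ⟨i, fun e v hv => by rw [hi e v hv]; exact (hs e v hv).1, d_i, ?_⟩
  refine P.H.V.hom_ext (f := P.clsL ∘ₗ i.codRestrict _ d_i) (g := LinearMap.id) fun e v hv => ?_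
  change P.cls (i v) = v
  rw [hi e v hv, (hs e v hv).2.2]

theorem CohomPres.sub_eq_d {y z : A.V.carrier} (hy : A.ops.d y = 0) (hz : A.ops.d z = 0)
    (h : P.cls y = P.cls z) : ∃ c, y - z = A.ops.d c := by
  have h₁ : P.cls (y - z) = 0 :=
    (map_sub P.clsL ⟨y, hy⟩ ⟨z, hz⟩).trans (sub_eq_zero.2 h)
  obtain ⟨c, hc⟩ := (P.cls_zero_iff (y - z)
    (by rw [← A.ops_d, map_sub, hy, hz, sub_zero])).1 h₁
  exact ⟨c, hc.trans (A.ops_d c).symm⟩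

theorem CohomPres.eq_zero_of_section {i : P.H.V.carrier →ₗ[K] A.V.carrier}
    (d_i : ∀ v, A.ops.d (i v) = 0) (cls_i : ∀ v, P.cls (i v) = v) {v : P.H.V.carrier}
    (h : ∃ c, i v = A.ops.d c) : v = 0 := by
  obtain ⟨c, hc⟩ := h
  rw [← cls_i v]
  exact (P.cls_zero_iff (i v) ((A.ops_d _).symm.trans (d_i v))).2 ⟨c, hc.trans (A.ops_d c)⟩

theorem CohomPres.exists_contraction :
    ∃ C : Contraction P.H.V.susp A.ops, ∀ v, P.cls (C.i v) = v := by
  obtain ⟨i, i_gr, d_i, cls_i⟩ := P.exists_section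
  obtain ⟨C, rfl⟩ := A.exists_contraction i i_gr d_i
    (fun v h => P.eq_zero_of_section d_i cls_i h)
    fun y hy => ⟨P.cls y, P.sub_eq_d hy (d_i _) (cls_i _).symm⟩
  exact ⟨C, cls_i⟩

theorem CohomPres.p_eq_cls {C : Contraction P.H.V.susp A.ops} (cls_i : ∀ v, P.cls (C.i v) = v)
    {y : A.V.carrier} (hy : A.ops.d y = 0) : C.p y = P.cls y := by
  obtain ⟨c, hc⟩ := P.sub_eq_d hy (C.d_i (P.cls y)) (cls_i _).symm
  rw [sub_eq_iff_eq_add] at hc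
  rw [hc, map_add, C.p_d, C.p_i, zero_add, ← hc]

theorem CohomPres.p_mul {C : Contraction P.H.V.susp A.ops} (cls_i : ∀ v, P.cls (C.i v) = v)
    (x y : P.H.V.carrier) :
    C.p (A.ops.μ (C.i (P.H.V.sgn x)) (C.i y)) = P.H.mul x y := by
  have h : ∀ v, C.i (P.H.V.sgn v) = A.V.sgn (C.i v) :=
    P.H.V.hom_ext (f := C.i ∘ₗ P.H.V.sgn) (g := A.V.sgn ∘ₗ C.i) fun e v hv => by
      have := C.i_gr (e - 1) v (by rwa [GVS.mem_susp, sub_add_cancel])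
      rw [GVS.mem_susp, sub_add_cancel] at this
      rw [LinearMap.comp_apply, LinearMap.comp_apply, P.H.V.sgn_apply hv, A.V.sgn_apply this,
        map_smul]
  have hd : ∀ v, A.d (C.i v) = 0 := fun v => (A.ops_d _).symm.trans (C.d_i v)
  rw [P.p_eq_cls cls_i, A.ops_μ, h, A.V.sgn_sgn, P.cls_mul _ _ (hd x) (hd y), cls_i, cls_i]
  rw [A.ops.d_μ, C.d_i, C.d_i, map_zero, map_zero, LinearMap.zero_apply, neg_zero, sub_zero]

/-- Kadeishvili's minimal model, on suspensions. -/
theorem CohomPres.exists_minimal :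
    ∃ (m : AInftyStr K P.H.V) (φ : AInftyHomData K P.H.V A.V),
      (∀ n, 1 ≤ n → m.Stasheff n) ∧ m.op 1 = 0 ∧ (∀ x y, m.op 2 ![x, y] = P.H.mul x y) ∧
      IsAInftyMorphism φ m A.str ∧ ∀ v, P.cls (φ.f1 v) = v := by
  obtain ⟨C, cls_i⟩ := P.exists_contraction
  obtain ⟨F, b, T, hF, hb⟩ := C.exists_twist
  have hm := AInftyStr.suspWords_ofWords T.b_ml T.b_deg T.b_nil
  have hφ := AInftyHomData.suspWords_ofWords T.F_ml T.F_deg T.F_nil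
  refine ⟨AInftyStr.ofWords T.b_ml T.b_deg, AInftyHomData.ofWords T.F_ml T.F_deg, ?_, ?_, ?_, ?_,
    ?_⟩
  · rw [stasheff_iff, hm]
    exact T.b_b
  · ext v
    have hv : v = fun _ => v 0 := funext fun i => by rw [Subsingleton.elim i 0]
    rw [hv, ← suspWords_singleton, hm, T.b_one]; rfl
  · intro x y
    have := suspWords_pair (AInftyStr.ofWords T.b_ml T.b_deg).op (P.H.V.sgn x) y
    rw [P.H.V.sgn_sgn, hm, hb, P.p_mul cls_i] at this
    exact this.symm
  · rw [isAInftyMorphism_iff, hm, hφ]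
    intro w
    rw [T.eqn, A.com_op T.F_nil]
  · intro v
    rw [← AInftyHomData.suspWords_singleton, hφ, hF, cls_i]

theorem AInftyHomData.IsQuasiIso.exists_contraction {V : GVS K} {m : AInftyStr K V}
    (hm : ∀ n, 1 ≤ n → m.Stasheff n) (h1 : m.op 1 = 0) {φ : AInftyHomData K V A.V}
    (hφ : IsAInftyMorphism φ m A.str) (hq : φ.IsQuasiIso m A.str) :
    ∃ C : Contraction V.susp A.ops, ∀ v, C.i v = φ.f1 v := by
  have T := AInftyHomData.twist hm h1 hφ
  have hi : ∀ v, T.F_ml.head [] v = φ.f1 v := φ.suspWords_singleton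
  have hdeg : ∀ e, ∀ v ∈ V.grading e, T.F_ml.head [] v ∈ A.V.grading e := fun e v hv => by
    have := T.F_deg [v] [e - 1] (by simpa [GVS.mem_susp] using hv)
    simpa [GVS.mem_susp] using this
  obtain ⟨C, hC⟩ := A.exists_contraction (T.F_ml.head []) hdeg T.d_letter
    (fun v ⟨c, hc⟩ => by
      obtain ⟨c', hc'⟩ := hq.1 v (AInftyStr.d_eq_zero h1 v)
        ⟨c, (hi v).symm.trans (hc.trans (A.ops_d c))⟩
      rw [hc', AInftyStr.d_eq_zero h1])
    (fun y hy => by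
      obtain ⟨v, -, c, hc⟩ := hq.2 y ((A.ops_d y).symm.trans hy)
      exact ⟨v, c, by rw [hi, hc]; exact (A.ops_d c).symm⟩)
  exact ⟨C, fun v => by rw [hC, hi]⟩

/-- Uniqueness of minimal models up to `A∞`-isomorphism. -/
theorem AInftyHomData.IsQuasiIso.exists_iso {V : GVS K} {m m' : AInftyStr K V}
    (hm : ∀ n, 1 ≤ n → m.Stasheff n) (h1 : m.op 1 = 0) {φ : AInftyHomData K V A.V}
    (hφ : IsAInftyMorphism φ m A.str) (hq : φ.IsQuasiIso m A.str)
    (hm' : ∀ n, 1 ≤ n → m'.Stasheff n) (h1' : m'.op 1 = 0) {φ' : AInftyHomData K V A.V}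
    (hφ' : IsAInftyMorphism φ' m' A.str) (hq' : φ'.IsQuasiIso m' A.str) :
    ∃ ψ : AInftyHomData K V V, IsAInftyMorphism ψ m m' ∧ Function.Bijective ψ.f1 := by
  have T := AInftyHomData.twist hm h1 hφ
  obtain ⟨C, hC⟩ := hq.exists_contraction hm h1 hφ
  obtain ⟨C', hC'⟩ := hq'.exists_contraction hm' h1' hφ'
  obtain ⟨ψ, hψ, hd, h0, hp, he⟩ := T.exists_morphism (AInftyHomData.twist hm' h1' hφ') C'
    fun v => (φ'.suspWords_singleton v).trans (hC' v).symm
  have hs := AInftyHomData.suspWords_ofWords hψ hd h0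
  refine ⟨AInftyHomData.ofWords hψ hd, by rw [isAInftyMorphism_iff, hs]; exact he, ?_⟩
  have hf : ∀ v, (AInftyHomData.ofWords hψ hd).f1 v = C'.p (C.i v) := fun v => by
    rw [← AInftyHomData.suspWords_singleton, hs, hp, φ.suspWords_singleton, hC]
  have hf' : (AInftyHomData.ofWords hψ hd).f1 = C'.p ∘ₗ C.i := funext hf
  rw [hf']
  constructor
  · refine (injective_iff_map_eq_zero _).2 fun v hv => ?_
    obtain ⟨v', -, c, hc⟩ := hq'.2 (C.i v) ((A.ops_d _).symm.trans (C.d_i v))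
    have hc' : C.i v - C'.i v' = A.ops.d c := by rw [hC', hc]; exact (A.ops_d c).symm
    have h := congrArg C'.p hc'
    rw [LinearMap.comp_apply] at hv
    rw [map_sub, hv, C'.p_i, C'.p_d, zero_sub, neg_eq_zero] at h
    rw [h, map_zero, sub_zero] at hc'
    rw [← C.p_i v, hc', C.p_d]
  · intro v'
    obtain ⟨v, -, c, hc⟩ := hq.2 (C'.i v') ((A.ops_d _).symm.trans (C'.d_i v'))
    have hc' : C'.i v' - C.i v = A.ops.d c := by rw [hC, hc]; exact (A.ops_d c).symm
    refine ⟨v, ?_⟩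
    have h := congrArg C'.p hc'
    rw [map_sub, C'.p_i, C'.p_d, sub_eq_zero] at h
    exact h.symm

end main

/-- **Kadeishvili.** For a dg-algebra `A` over a field of
characteristic `0`, the cohomology algebra `H(A)` carries an `A∞`-structure with
`m₁ = 0` and `m₂` the induced product, together with an `A∞`-quasi-isomorphism
`H(A) → A`; moreover this structure is unique up to `A∞`-isomorphism. -/
theorem kadeishvili
    (K : Type) [Field K] [CharZero K] (A : DGAlg K) (P : CohomPres K A) :
    ∃ m : AInftyStr K P.H.V,
      (∀ n, 1 ≤ n → m.Stasheff n) ∧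
      m.op 1 = 0 ∧
      (∀ x y, m.op 2 ![x, y] = P.H.mul x y) ∧
      (∃ φ : AInftyHomData K P.H.V A.V,
        IsAInftyMorphism φ m A.str ∧ φ.IsQuasiIso m A.str) ∧
      (∀ m' : AInftyStr K P.H.V,
        (∀ n, 1 ≤ n → m'.Stasheff n) →
        m'.op 1 = 0 →
        (∀ x y, m'.op 2 ![x, y] = P.H.mul x y) →
        (∃ φ : AInftyHomData K P.H.V A.V,
          IsAInftyMorphism φ m' A.str ∧ φ.IsQuasiIso m' A.str) →
        ∃ ψ : AInftyHomData K P.H.V P.H.V,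
          IsAInftyMorphism ψ m m' ∧ Function.Bijective ψ.f1) := by
  obtain ⟨m, φ, hm, h1, h2, hφ, cls_f1⟩ := P.exists_minimal
  have hd : ∀ v, A.d (φ.f1 v) = 0 := fun v => by
    have := (AInftyHomData.twist hm h1 hφ).d_letter v
    rwa [φ.suspWords_singleton, A.ops_d] at this
  have hq : φ.IsQuasiIso m A.str := by
    refine ⟨fun x _ hx => ⟨0, ?_⟩, fun y hy => ⟨P.cls y, AInftyStr.d_eq_zero h1 _, ?_⟩⟩
    · rw [AInftyStr.d_eq_zero h1, ← cls_f1 x]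
      exact (P.cls_zero_iff _ (hd x)).2 hx
    · obtain ⟨c, hc⟩ := P.sub_eq_d ((A.ops_d y).trans hy) ((A.ops_d _).trans (hd (P.cls y)))
        (cls_f1 _).symm
      exact ⟨c, hc.trans (A.ops_d c)⟩
  refine ⟨m, hm, h1, h2, ⟨φ, hφ, hq⟩, fun m' hm' h1' _ ⟨φ', hφ', hq'⟩ => ?_⟩
  exact hq.exists_iso hm h1 hφ hm' h1' hφ' hq'
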